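/- arXiv:2405.17638 — 2 statements merged into one kernel-verified Lean document; each statement's English description precedes it below -/
import Mathlib

section
/- Assume P is irreducible; μ(k) ≥ α/n for every k ∈ D, where α > 0; and there are constants C > 0 and β > 0 such that S^t(i,j) ≤ C·e^{−β·d(i,j)²} for every i ∈ D, every j ∈ [n] with j ≠ i, and every 1 ≤ t ≤ τ. Then for every i ∈ D, σ_i² ≤ (C/α)·τ·e^{(log c)²/β}·n³·u(i)². -/
open MeasureTheory Finset Filter
open scoped ENNReal NNReal ENat

noncomputable section

namespace RareTD

variable {n : ℕ}

/-- `P` is a row-stochastic matrix. -/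
def IsStochastic (P : Matrix (Fin n) (Fin n) ℝ) : Prop :=
  (∀ i j, 0 ≤ P i j) ∧ ∀ i, ∑ j, P i j = 1

/-- Irreducibility of a nonnegative matrix. -/
def IsIrreducible (P : Matrix (Fin n) (Fin n) ℝ) : Prop :=
  ∀ i j, ∃ m : ℕ, 0 < m ∧ 0 < (P ^ m) i j

/-- `Pr i` is the law of the Markov chain with transition matrix `P` started at `i`,
characterized by its finite-dimensional distributions. -/
def IsMarkovFamily (P : Matrix (Fin n) (Fin n) ℝ)
    (Pr : Fin n → Measure (ℕ → Fin n)) : Prop :=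
  (∀ i, IsProbabilityMeasure (Pr i)) ∧
    ∀ (i : Fin n) (m : ℕ) (x : ℕ → Fin n),
      (Pr i {ω | ∀ t ≤ m, ω t = x t}).toReal =
        (if x 0 = i then 1 else 0) * ∏ t ∈ Finset.range m, P (x t) (x (t + 1))

/-- The matrix `S` of the chain stopped on exiting `D`. -/
def stopMat (P : Matrix (Fin n) (Fin n) ℝ) (D : Finset (Fin n)) :
    Matrix (Fin n) (Fin n) ℝ :=
  fun i j => if i ∈ D then P i j else if i = j then 1 else 0

/-- Exit time `T = min {t ≥ 0 : ω t ∉ D}`, with value `⊤` if the path never leaves `D`. -/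
def exitT (D : Finset (Fin n)) (ω : ℕ → Fin n) : ℕ∞ :=
  ⨅ (t : ℕ) (_ : ω t ∉ D), (t : ℕ∞)

/-- Hitting time of a set at positive times, `min {t > 0 : ω t ∈ A}`. -/
def hitT (A : Set (Fin n)) (ω : ℕ → Fin n) : ℕ∞ :=
  ⨅ (t : ℕ) (_ : 0 < t ∧ ω t ∈ A), (t : ℕ∞)

/-- The stopped path `t ↦ X_{t ∧ T}`. -/
def stopped (D : Finset (Fin n)) (ω : ℕ → Fin n) : ℕ → Fin n
  | 0 => ω 0
  | t + 1 => if stopped D ω t ∈ D then ω (t + 1) else stopped D ω t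

/-- `R_D`, the reward restricted to `D`. -/
def RD (D : Finset (Fin n)) (R : Fin n → ℝ) : Fin n → ℝ := fun i => if i ∈ D then R i else 0

/-- The value function `u(i) = E_i[∑_{t=0}^{T} R(X_t)]`, in `[0,∞]`. -/
def valueE (Pr : Fin n → Measure (ℕ → Fin n)) (D : Finset (Fin n)) (R : Fin n → ℝ)
    (i : Fin n) : ℝ≥0∞ :=
  ∑' t : ℕ, ∫⁻ ω, Set.indicator {ω' : ℕ → Fin n | (t : ℕ∞) ≤ exitT D ω'}
      (fun ω' => ENNReal.ofReal (R (ω' t))) ω ∂(Pr i)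

/-- The real-valued value function. -/
def valueR (Pr : Fin n → Measure (ℕ → Fin n)) (D : Finset (Fin n)) (R : Fin n → ℝ)
    (i : Fin n) : ℝ := (valueE Pr D R i).toReal

/-- Replace by `0` every row and column with index outside `D`. -/
def zeroD (D : Finset (Fin n)) (M : Matrix (Fin n) (Fin n) ℝ) : Matrix (Fin n) (Fin n) ℝ :=
  fun i j => if i ∈ D ∧ j ∈ D then M i j else 0

/-- The asymptotic variance `σ_i²` of the LSTD estimator. -/
def avar (P : Matrix (Fin n) (Fin n) ℝ) (Pr : Fin n → Measure (ℕ → Fin n))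
    (D : Finset (Fin n)) (R : Fin n → ℝ) (μ : Fin n → ℝ) (τ : ℕ) (i : Fin n) : ℝ :=
  ∑ k ∈ D, (μ k)⁻¹ * ((((1 : Matrix (Fin n) (Fin n) ℝ) - zeroD D (stopMat P D ^ τ))⁻¹) i k) ^ 2 *
    ∫ ω, (∑ t ∈ Finset.range τ, RD D R (stopped D ω t)
        + valueR Pr D R (stopped D ω τ) - valueR Pr D R k) ^ 2 ∂(Pr k)

/-- Mean exit time `E_i[T] = ∑_{t≥0} P_i[T > t]`, in `[0,∞]`. -/
def meanExit (Pr : Fin n → Measure (ℕ → Fin n)) (D : Finset (Fin n)) (i : Fin n) : ℝ≥0∞ :=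
  ∑' t : ℕ, Pr i {ω | (t : ℕ∞) < exitT D ω}

/-- The event `T_ℓ^τ < min (T_k^τ, T_{Dᶜ∖{ℓ}}^τ)` for the `τ`-step chain. -/
def Qset (D : Finset (Fin n)) (k ℓ : Fin n) : Set (ℕ → Fin n) :=
  {ω | hitT {ℓ} ω < min (hitT {k} ω) (hitT ((D : Set (Fin n))ᶜ \ {ℓ}) ω)}

/-- Green's function of the `τ`-step chain: `E_i[∑_{t=0}^{T^τ-1} 1{Y_t^τ = k}]`. -/
def greenY (PrY : Fin n → Measure (ℕ → Fin n)) (D : Finset (Fin n)) (i k : Fin n) : ℝ≥0∞ :=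
  ∑' t : ℕ, PrY i {ω | (t : ℕ∞) < exitT D ω ∧ ω t = k}

/-- Green's function of the chain: `E_ℓ[∑_{t=0}^{T} 1{X_t = j}]` (the sum includes `t = T`). -/
def greenX (Pr : Fin n → Measure (ℕ → Fin n)) (D : Finset (Fin n)) (ℓ j : Fin n) : ℝ≥0∞ :=
  ∑' t : ℕ, Pr ℓ {ω | (t : ℕ∞) ≤ exitT D ω ∧ ω t = j}


/-- Lengths of paths from `k` to `ℓ` in the minorizing graph (edges `i → j` with `A i j ≥ c`)
whose intermediate vertices lie in `D \ {k}`. -/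
def pathLens {n : ℕ} (A : Matrix (Fin n) (Fin n) ℝ) (c : ℝ) (D : Finset (Fin n))
    (k ℓ : Fin n) : Set ℕ :=
  {d | ∃ v : ℕ → Fin n, v 0 = k ∧ v d = ℓ ∧
    (∀ m, 0 < m → m < d → v m ∈ D ∧ v m ≠ k) ∧
    ∀ m < d, c ≤ A (v m) (v (m + 1))}

/-- The graph distance `d(k,ℓ)`: the minimal length of a path from `k` to `ℓ` in the minorizing
graph whose intermediate vertices lie in `D \ {k}`. -/
noncomputable def gdist {n : ℕ} (A : Matrix (Fin n) (Fin n) ℝ) (c : ℝ) (D : Finset (Fin n))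
    (k ℓ : Fin n) : ℕ :=
  sInf (pathLens A c D k ℓ)

/-- From every state of `B` a path with positive transitions (while in `B`) leads out of `B`. -/
def Escapes (A : Matrix (Fin n) (Fin n) ℝ) (B : Finset (Fin n)) : Prop :=
  ∀ i ∈ B, ∃ (v : ℕ → Fin n) (d : ℕ), v 0 = i ∧ v d ∉ B ∧
    ∀ m < d, v m ∈ B → 0 < A (v m) (v (m + 1))

theorem Escapes.mono {A : Matrix (Fin n) (Fin n) ℝ} {B B' : Finset (Fin n)}
    (h : Escapes A B) (hB : B' ⊆ B) : Escapes A B' := by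
  intro i hi
  obtain ⟨v, d, h0, hd, hv⟩ := h i (hB hi)
  exact ⟨v, d, h0, fun h => hd (hB h), fun m hm hmB => hv m hm (hB hmB)⟩

theorem mulVec_apply (A : Matrix (Fin n) (Fin n) ℝ) (f : Fin n → ℝ) (i : Fin n) :
    (A.mulVec f) i = ∑ j, A i j * f j := rfl

/-- The minimum principle. -/
theorem nonneg_of_superharmonic {A : Matrix (Fin n) (Fin n) ℝ} (hA : IsStochastic A)
    {B : Finset (Fin n)} (hB : Escapes A B) {f : Fin n → ℝ} (hout : ∀ i ∉ B, 0 ≤ f i)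
    (hin : ∀ i ∈ B, (A.mulVec f) i ≤ f i) (i : Fin n) : 0 ≤ f i := by
  obtain ⟨a, -, ha⟩ := Finset.exists_min_image Finset.univ f ⟨i, Finset.mem_univ i⟩
  refine le_trans ?_ (ha i (Finset.mem_univ i))
  by_contra! hneg
  have mem : ∀ j, f j = f a → j ∈ B := fun j hj => by
    by_contra hjB
    linarith [hout j hjB]
  obtain ⟨v, d, h0, hd, hv⟩ := hB a (mem a rfl)
  have key : ∀ m ≤ d, f (v m) = f a := by
    intro m
    induction m with
    | zero => intro _; rw [h0]
    | succ m ih =>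
      intro hm
      have hfm := ih (by omega)
      have hmB := mem _ hfm
      have hpos := hv m (by omega) hmB
      have h1 := hin _ hmB
      rw [hfm] at h1
      have h2 : ∑ j, A (v m) j * (f j - f a) ≤ 0 := by
        have : ∑ j, A (v m) j * (f j - f a) = (A.mulVec f) (v m) - f a := by
          simp only [mul_sub, Finset.sum_sub_distrib, ← Finset.sum_mul, hA.2, one_mul]
          rfl
        linarith
      have h3 : A (v m) (v (m + 1)) * (f (v (m + 1)) - f a) ≤ 0 :=
        le_trans (Finset.single_le_sum
          (f := fun j => A (v m) j * (f j - f a))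
          (fun j _ => mul_nonneg (hA.1 _ _) (sub_nonneg.2 (ha j (Finset.mem_univ j))))
          (Finset.mem_univ (v (m + 1)))) h2
      have h4 := ha (v (m + 1)) (Finset.mem_univ _)
      nlinarith
  exact hd (mem _ (key d le_rfl))

theorem zeroD_mulVec {A : Matrix (Fin n) (Fin n) ℝ} {D : Finset (Fin n)} {x : Fin n → ℝ}
    (hx : ∀ i ∉ D, x i = 0) {i : Fin n} (hi : i ∈ D) :
    ((zeroD D A).mulVec x) i = (A.mulVec x) i := by
  simp only [mulVec_apply]
  refine Finset.sum_congr rfl fun j _ => ?_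
  by_cases hj : j ∈ D
  · simp [zeroD, hi, hj]
  · simp [hx j hj]

theorem zeroD_mulVec_of_notMem {A : Matrix (Fin n) (Fin n) ℝ} {D : Finset (Fin n)}
    (x : Fin n → ℝ) {i : Fin n} (hi : i ∉ D) : ((zeroD D A).mulVec x) i = 0 := by
  simp [mulVec_apply, zeroD, hi]

theorem isUnit_one_sub_zeroD {A : Matrix (Fin n) (Fin n) ℝ} (hA : IsStochastic A)
    {D : Finset (Fin n)} (hD : Escapes A D) : IsUnit (1 - zeroD D A) := by
  rw [Matrix.isUnit_iff_isUnit_det, isUnit_iff_ne_zero, Ne, ← Matrix.exists_mulVec_eq_zero_iff]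
  rintro ⟨x, hx0, hx⟩
  rw [Matrix.sub_mulVec, Matrix.one_mulVec, sub_eq_zero] at hx
  have h0 : ∀ i ∉ D, x i = 0 := fun i hi => by
    rw [hx, zeroD_mulVec_of_notMem x hi]
  have h1 : ∀ i ∈ D, (A.mulVec x) i = x i := fun i hi => by
    rw [← zeroD_mulVec h0 hi, ← hx]
  refine hx0 (funext fun i => le_antisymm ?_ ?_)
  · have := nonneg_of_superharmonic hA hD (f := -x) (fun i hi => by simp [h0 i hi])
      (fun i hi => by rw [Matrix.mulVec_neg, Pi.neg_apply, h1 i hi, Pi.neg_apply]) i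
    simpa using this
  · exact nonneg_of_superharmonic hA hD (fun i hi => (h0 i hi).ge) (fun i hi => (h1 i hi).le) i

/-- The Green operator solves the Poisson equation with zero boundary values. -/
theorem green_spec {A : Matrix (Fin n) (Fin n) ℝ} (hA : IsStochastic A)
    {D : Finset (Fin n)} (hD : Escapes A D) {b : Fin n → ℝ} (hb : ∀ i ∉ D, b i = 0) :
    (∀ i ∉ D, ((1 - zeroD D A)⁻¹.mulVec b) i = 0) ∧
      ∀ i ∈ D, ((1 - zeroD D A)⁻¹.mulVec b) i
        = (A.mulVec ((1 - zeroD D A)⁻¹.mulVec b)) i + b i := by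
  have hu := isUnit_one_sub_zeroD hA hD
  set x := (1 - zeroD D A)⁻¹.mulVec b with hx
  have h1 : x - (zeroD D A).mulVec x = b := by
    have : (1 - zeroD D A).mulVec x = b := by
      rw [hx, Matrix.mulVec_mulVec, Matrix.mul_nonsing_inv _ ((Matrix.isUnit_iff_isUnit_det _).1 hu),
        Matrix.one_mulVec]
    rwa [Matrix.sub_mulVec, Matrix.one_mulVec] at this
  have h0 : ∀ i ∉ D, x i = 0 := fun i hi => by
    have := congrFun h1 i
    rw [Pi.sub_apply, zeroD_mulVec_of_notMem x hi, hb i hi] at this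
    linarith
  refine ⟨h0, fun i hi => ?_⟩
  have := congrFun h1 i
  rw [Pi.sub_apply, zeroD_mulVec h0 hi] at this
  linarith

theorem mulVec_nonneg_of_nonneg {A : Matrix (Fin n) (Fin n) ℝ} (hA : IsStochastic A)
    {f : Fin n → ℝ} (hf : ∀ i, 0 ≤ f i) (i : Fin n) : 0 ≤ (A.mulVec f) i := by
  rw [mulVec_apply]
  exact Finset.sum_nonneg fun j _ => mul_nonneg (hA.1 i j) (hf j)

theorem mulVec_mono {A : Matrix (Fin n) (Fin n) ℝ} (hA : IsStochastic A)
    {f g : Fin n → ℝ} (hf : ∀ i, f i ≤ g i) (i : Fin n) : (A.mulVec f) i ≤ (A.mulVec g) i := by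
  simp only [mulVec_apply]
  exact Finset.sum_le_sum fun j _ => mul_le_mul_of_nonneg_left (hf j) (hA.1 i j)

theorem mulVec_const {A : Matrix (Fin n) (Fin n) ℝ} (hA : IsStochastic A) (a : ℝ) :
    A.mulVec (fun _ => a) = fun _ => a := by
  funext i
  simp [Matrix.mulVec, dotProduct, ← Finset.sum_mul, hA.2]

/-- A nonnegative function superharmonic on `D \ {k}` is controlled along paths issued from `k`. -/
theorem pow_gdist_mul_le {A : Matrix (Fin n) (Fin n) ℝ} (hA : IsStochastic A)
    {D : Finset (Fin n)} {c : ℝ} (hc : 0 < c) {k ℓ : Fin n} (hkℓ : ℓ ≠ k)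
    (hconn : (pathLens A c D k ℓ).Nonempty) {f : Fin n → ℝ} (hf : ∀ i, 0 ≤ f i)
    (hin : ∀ i ∈ D, i ≠ k → (A.mulVec f) i ≤ f i) :
    c ^ gdist A c D k ℓ * f ℓ ≤ (A.mulVec f) k := by
  obtain ⟨v, h0, hd, hmid, hedge⟩ := Nat.sInf_mem hconn
  change v (gdist A c D k ℓ) = ℓ at hd
  change ∀ m, 0 < m → m < gdist A c D k ℓ → v m ∈ D ∧ v m ≠ k at hmid
  change ∀ m < gdist A c D k ℓ, c ≤ A (v m) (v (m + 1)) at hedge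
  generalize gdist A c D k ℓ = d at hd hmid hedge
  have step : ∀ m < d, c * f (v (m + 1)) ≤ (A.mulVec f) (v m) := fun m hm =>
    (mul_le_mul_of_nonneg_right (hedge m hm) (hf _)).trans
      (Finset.single_le_sum (f := fun j => A (v m) j * f j)
        (fun j _ => mul_nonneg (hA.1 _ _) (hf j)) (Finset.mem_univ (v (m + 1))))
  have key : ∀ m < d, c ^ (m + 1) * f (v (m + 1)) ≤ (A.mulVec f) k := by
    intro m
    induction m with
    | zero => intro hm; simpa [h0] using step 0 hm
    | succ m ih =>
      intro hm
      obtain ⟨hmD, hmk⟩ := hmid (m + 1) (by omega) hm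
      have h1 := (step (m + 1) hm).trans (hin _ hmD hmk)
      calc c ^ (m + 1 + 1) * f (v (m + 1 + 1))
          = c ^ (m + 1) * (c * f (v (m + 1 + 1))) := by ring
        _ ≤ c ^ (m + 1) * f (v (m + 1)) := by gcongr
        _ ≤ _ := ih (by omega)
  cases d with
  | zero => exact absurd (hd.symm.trans h0) hkℓ
  | succ m => rw [← hd]; exact key m (by omega)

/-- `g = G(·, k)` for the Green function `G` of the chain `A` killed outside `D`. -/
structure IsGreenColumn (A : Matrix (Fin n) (Fin n) ℝ) (D : Finset (Fin n)) (k : Fin n)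
    (g : Fin n → ℝ) : Prop where
  mem : k ∈ D
  zero : ∀ i ∉ D, g i = 0
  harmonic : ∀ i ∈ D, i ≠ k → g i = (A.mulVec g) i
  pole : g k = (A.mulVec g) k + 1

namespace IsGreenColumn

variable {A : Matrix (Fin n) (Fin n) ℝ} {D : Finset (Fin n)} {k : Fin n} {g : Fin n → ℝ}

theorem nonneg (h : IsGreenColumn A D k g) (hA : IsStochastic A) (hD : Escapes A D)
    (i : Fin n) : 0 ≤ g i := by
  refine nonneg_of_superharmonic hA hD (fun i hi => (h.zero i hi).ge) (fun i hi => ?_) i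
  by_cases hik : i = k
  · rw [hik, h.pole]; linarith
  · exact (h.harmonic i hi hik).ge

theorem one_le (h : IsGreenColumn A D k g) (hA : IsStochastic A) (hD : Escapes A D) :
    1 ≤ g k := by
  have := mulVec_nonneg_of_nonneg hA (h.nonneg hA hD) k
  linarith [h.pole]

theorem le_pole (h : IsGreenColumn A D k g) (hA : IsStochastic A) (hD : Escapes A D)
    (i : Fin n) : g i ≤ g k := by
  have := nonneg_of_superharmonic (f := fun j => g k - g j) hA
    (hD.mono (Finset.erase_subset k D)) (fun j hj => ?_) (fun j hj => ?_) i
  · linarith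
  · by_cases hjk : j = k
    · simp [hjk]
    · have : j ∉ D := fun h' => hj (Finset.mem_erase.2 ⟨hjk, h'⟩)
      simp only [h.zero j this]
      linarith [h.one_le hA hD]
  · obtain ⟨hjk, hjD⟩ := Finset.mem_erase.1 hj
    change A.mulVec ((fun _ => g k) - g) j ≤ _
    rw [Matrix.mulVec_sub, mulVec_const hA, Pi.sub_apply, ← h.harmonic j hjD hjk]

theorem mul_le_mul (h : IsGreenColumn A D k g) (hA : IsStochastic A) (hD : Escapes A D)
    {u : Fin n → ℝ} (hu : ∀ i, 0 ≤ u i) (hAu : ∀ i, (A.mulVec u) i ≤ u i) (i : Fin n) :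
    g i * u k ≤ g k * u i := by
  have h1 := h.one_le hA hD
  have := nonneg_of_superharmonic (f := g k • u - u k • g) hA
    (hD.mono (Finset.erase_subset k D)) (fun j hj => ?_) (fun j hj => ?_) i
  · simp at this; linarith
  · by_cases hjk : j = k
    · simp [hjk, mul_comm]
    · have : j ∉ D := fun h' => hj (Finset.mem_erase.2 ⟨hjk, h'⟩)
      simp only [Pi.sub_apply, Pi.smul_apply, smul_eq_mul, h.zero j this]
      have := mul_nonneg (by linarith : 0 ≤ g k) (hu j)
      linarith
  · obtain ⟨hjk, hjD⟩ := Finset.mem_erase.1 hj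
    rw [Matrix.mulVec_sub, Matrix.mulVec_smul, Matrix.mulVec_smul]
    simp only [Pi.sub_apply, Pi.smul_apply, smul_eq_mul, ← h.harmonic j hjD hjk]
    have := mul_le_mul_of_nonneg_left (hAu j) (by linarith : 0 ≤ g k)
    linarith

/-- Oscillation bound for superharmonic functions in terms of the Green function. -/
theorem pow_gdist_mul_abs_le (h : IsGreenColumn A D k g) (hA : IsStochastic A)
    (hD : Escapes A D) {u : Fin n → ℝ} (hu : ∀ i, 0 ≤ u i) (hAu : ∀ i, (A.mulVec u) i ≤ u i)
    {c : ℝ} (hc : 0 < c) {ℓ : Fin n} (hkℓ : ℓ ≠ k) (hconn : (pathLens A c D k ℓ).Nonempty) :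
    c ^ gdist A c D k ℓ * (g k * |u ℓ - u k|) ≤ u k := by
  have hg1 := h.one_le hA hD
  have hcd : 0 < c ^ gdist A c D k ℓ := by positivity
  have hle := h.le_pole hA hD
  have hmul := h.mul_le_mul hA hD hu hAu
  rcases abs_cases (u ℓ - u k) with ⟨he, -⟩ | ⟨he, -⟩ <;> rw [he]
  · have := pow_gdist_mul_le hA hc hkℓ hconn (f := g k • u - u k • g)
      (fun j => by simp; linarith [hmul j]) (fun j hjD hjk => ?_)
    · rw [Matrix.mulVec_sub, Matrix.mulVec_smul, Matrix.mulVec_smul] at this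
      simp only [Pi.sub_apply, Pi.smul_apply, smul_eq_mul] at this
      have h2 := mul_le_mul_of_nonneg_left (hAu k) (by linarith : 0 ≤ g k)
      have h3 : (A.mulVec g) k = g k - 1 := by linarith [h.pole]
      rw [h3] at this
      calc c ^ gdist A c D k ℓ * (g k * (u ℓ - u k))
          ≤ c ^ gdist A c D k ℓ * (g k * u ℓ - u k * g ℓ) := by
            refine mul_le_mul_of_nonneg_left ?_ hcd.le
            nlinarith [hle ℓ, hu k]
        _ ≤ u k := by linarith
    · rw [Matrix.mulVec_sub, Matrix.mulVec_smul, Matrix.mulVec_smul]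
      simp only [Pi.sub_apply, Pi.smul_apply, smul_eq_mul, ← h.harmonic j hjD hjk]
      have := mul_le_mul_of_nonneg_left (hAu j) (by linarith : 0 ≤ g k)
      linarith
  · have := pow_gdist_mul_le hA hc hkℓ hconn (f := (fun _ => g k) - g)
      (fun j => by simpa using hle j) (fun j hjD hjk => ?_)
    · rw [Matrix.mulVec_sub, mulVec_const hA] at this
      simp only [Pi.sub_apply] at this
      have h3 : (A.mulVec g) k = g k - 1 := by linarith [h.pole]
      rw [h3, sub_sub_cancel] at this
      calc c ^ gdist A c D k ℓ * (g k * -(u ℓ - u k))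
          ≤ c ^ gdist A c D k ℓ * ((g k - g ℓ) * u k) := by
            refine mul_le_mul_of_nonneg_left ?_ hcd.le
            linarith [hmul ℓ]
        _ ≤ u k := by nlinarith [hu k]
    · rw [Matrix.mulVec_sub, mulVec_const hA, Pi.sub_apply, Pi.sub_apply,
        ← h.harmonic j hjD hjk]

end IsGreenColumn

theorem isGreenColumn_inv {A : Matrix (Fin n) (Fin n) ℝ} (hA : IsStochastic A)
    {D : Finset (Fin n)} (hD : Escapes A D) {k : Fin n} (hk : k ∈ D) :
    IsGreenColumn A D k (fun i => (1 - zeroD D A)⁻¹ i k) := by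
  have hcol : (1 - zeroD D A)⁻¹.mulVec (Pi.single k 1) = fun i => (1 - zeroD D A)⁻¹ i k := by
    funext i; simp
  obtain ⟨h0, h1⟩ := green_spec hA hD (b := Pi.single k 1)
    (fun i hi => Pi.single_eq_of_ne (by rintro rfl; exact hi hk) _)
  rw [hcol] at h0 h1
  exact ⟨hk, h0, fun i hi hik => by simpa [hik] using h1 i hi, by simpa using h1 k hk⟩

section Markov

variable {P : Matrix (Fin n) (Fin n) ℝ} {Pr : Fin n → Measure (ℕ → Fin n)}

theorem integrable_of_dependsOn {ν : Measure (ℕ → Fin n)} [IsFiniteMeasure ν] {m : ℕ}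
    {F : (ℕ → Fin n) → ℝ} (hF : DependsOn F (Set.Iic m)) : Integrable F ν := by
  set r : (ℕ → Fin n) → (Fin (m + 1) → Fin n) := fun ω t => ω t
  set G : (Fin (m + 1) → Fin n) → ℝ := fun x => F fun t => x ⟨min t m, by omega⟩
  have hr : Measurable r := measurable_pi_lambda _ fun t => measurable_pi_apply _
  have hFG : F = G ∘ r := by
    funext ω
    exact hF fun t ht => by simp [r, min_eq_left (Set.mem_Iic.1 ht)]
  rw [hFG]
  exact (Integrable.of_finite (μ := ν.map r)).comp_measurable hr

/-- The Markov property, at a deterministic time and for the one-step transition. -/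
theorem integral_next (hPr : IsMarkovFamily P Pr) (k j : Fin n) {m : ℕ}
    {F : (ℕ → Fin n) → ℝ} (hF : DependsOn F (Set.Iic m)) :
    ∫ ω, (if ω (m + 1) = j then F ω else 0) ∂(Pr k) = ∫ ω, P (ω m) j * F ω ∂(Pr k) := by
  have := hPr.1 k
  set e : (Fin (m + 1) → Fin n) → ℕ → Fin n := fun x t => x ⟨min t m, by omega⟩ with he
  have hiff : ∀ (ω : ℕ → Fin n) (x : Fin (m + 1) → Fin n),
      (∀ t ≤ m, ω t = e x t) ↔ x = fun t : Fin (m + 1) => ω t := by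
    refine fun ω x => ⟨fun h => funext fun t => ?_, fun h t ht => ?_⟩
    · have := h t (by omega)
      rw [this]
      simp only [he]
      congr 1
      exact Fin.ext (by simp; omega)
    · simp [he, h, min_eq_left ht]
  have meas : ∀ (M : ℕ) (y : ℕ → Fin n), MeasurableSet {ω : ℕ → Fin n | ∀ t ≤ M, ω t = y t} := by
    intro M y
    simp only [Set.ofPred_forall]
    exact MeasurableSet.iInter fun t => MeasurableSet.iInter fun _ =>
      measurable_pi_apply (X := fun _ : ℕ => Fin n) t (measurableSet_singleton (y t))
  have decomp : ∀ Φ : (ℕ → Fin n) → ℝ, ∀ ω,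
      Φ ω = ∑ x, Set.indicator {ω | ∀ t ≤ m, ω t = e x t} Φ ω := by
    intro Φ ω
    simp only [Set.indicator_apply, Set.mem_ofPred_eq, hiff]
    simp
  set y : (Fin (m + 1) → Fin n) → ℕ → Fin n := fun x t => if t ≤ m then e x t else j
  have hL : ∀ ω, (if ω (m + 1) = j then F ω else 0)
      = ∑ x, Set.indicator {ω | ∀ t ≤ m + 1, ω t = y x t} (fun _ => F (e x)) ω := by
    intro ω
    rw [decomp (fun ω => if ω (m + 1) = j then F ω else 0) ω]
    refine Finset.sum_congr rfl fun x _ => ?_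
    have h1 : (∀ t ≤ m + 1, ω t = y x t) ↔ (∀ t ≤ m, ω t = e x t) ∧ ω (m + 1) = j := by
      constructor
      · intro h
        exact ⟨fun t ht => by simpa [y, ht] using h t (by omega), by simpa [y] using h (m + 1) le_rfl⟩
      · rintro ⟨h, h'⟩ t ht
        rcases Nat.lt_or_ge m t with h2 | h2
        · obtain rfl : t = m + 1 := by omega
          simpa [y] using h'
        · simpa [y, h2] using h t h2
    simp only [Set.indicator_apply, Set.mem_ofPred_eq, h1, ite_and]
    split_ifs with h2 h3
    · exact hF h2
    · rfl
    · rfl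
  have hR : ∀ ω, P (ω m) j * F ω
      = ∑ x, Set.indicator {ω | ∀ t ≤ m, ω t = e x t} (fun _ => P (e x m) j * F (e x)) ω := by
    intro ω
    rw [decomp (fun ω => P (ω m) j * F ω) ω]
    refine Finset.sum_congr rfl fun x _ => ?_
    simp only [Set.indicator_apply, Set.mem_ofPred_eq]
    split_ifs with h2
    · rw [hF h2, h2 m le_rfl]
    · rfl
  rw [integral_congr_ae (.of_forall hL), integral_congr_ae (.of_forall hR),
    integral_finsetSum _ fun x _ => (integrable_const _).indicator (meas _ _),
    integral_finsetSum _ fun x _ => (integrable_const _).indicator (meas _ _)]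
  refine Finset.sum_congr rfl fun x _ => ?_
  rw [integral_indicator_const _ (meas _ _), integral_indicator_const _ (meas _ _), Measure.real,
    Measure.real, hPr.2, hPr.2, Finset.prod_range_succ]
  have h1 : ∏ t ∈ Finset.range m, P (y x t) (y x (t + 1))
      = ∏ t ∈ Finset.range m, P (e x t) (e x (t + 1)) := by
    refine Finset.prod_congr rfl fun t ht => ?_
    have := Finset.mem_range.1 ht
    simp [y, this.le, Nat.succ_le_of_lt this]
  rw [h1]
  simp only [y, Nat.zero_le, le_refl, if_true, Nat.not_succ_le_self, if_false, smul_eq_mul]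
  ring

theorem ae_zero_eq (hPr : IsMarkovFamily P Pr) (k : Fin n) : ∀ᵐ ω ∂(Pr k), ω 0 = k := by
  have := hPr.1 k
  have h := hPr.2 k 0 fun _ => k
  have hset : {ω : ℕ → Fin n | ∀ t ≤ 0, ω t = k} = {ω | ω 0 = k} := by
    ext ω; simp
  simp only [if_true, Finset.range_zero, Finset.prod_empty, mul_one, hset] at h
  rw [ae_iff_prob_eq_one, ← ENNReal.toReal_eq_one_iff, h]
  exact (measurable_of_finite (· = k)).comp (measurable_pi_apply 0)

variable {D : Finset (Fin n)}

theorem stopped_congr {ω ω' : ℕ → Fin n} {m : ℕ} (h : ∀ t ≤ m, ω t = ω' t) :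
    ∀ t ≤ m, stopped D ω t = stopped D ω' t := by
  intro t
  induction t with
  | zero => intro ht; exact h 0 ht
  | succ t ih =>
    intro ht
    simp only [stopped, ih (by omega), h (t + 1) ht]

theorem stopped_eq_of_mem {ω : ℕ → Fin n} {m : ℕ} (h : stopped D ω m ∈ D) :
    stopped D ω m = ω m := by
  cases m with
  | zero => rfl
  | succ m =>
    simp only [stopped] at h ⊢
    split_ifs with h1
    · rfl
    · simp [h1] at h

theorem dependsOn_stopped {m : ℕ} (φ : Fin n → ℝ) :
    DependsOn (fun ω : ℕ → Fin n => φ (stopped D ω m)) (Set.Iic m) := fun ω ω' h => by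
  simp only [stopped_congr (D := D) h m le_rfl]

/-- The Markov property for the stopped chain. -/
theorem integral_stopped_next (hPr : IsMarkovFamily P Pr) (k : Fin n) {m : ℕ}
    {H : (ℕ → Fin n) → Fin n → ℝ} (hH : ∀ j, DependsOn (fun ω => H ω j) (Set.Iic m)) :
    ∫ ω, H ω (stopped D ω (m + 1)) ∂(Pr k)
      = ∫ ω, ∑ j, stopMat P D (stopped D ω m) j * H ω j ∂(Pr k) := by
  have := hPr.1 k
  set A : (ℕ → Fin n) → ℝ := fun ω => if stopped D ω m ∈ D then 0 else H ω (stopped D ω m)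
  set F : Fin n → (ℕ → Fin n) → ℝ := fun j ω => if stopped D ω m ∈ D then H ω j else 0
  have hA : DependsOn A (Set.Iic m) := fun ω ω' h => by
    simp only [A, stopped_congr (D := D) h m le_rfl, hH _ h]
  have hF : ∀ j, DependsOn (F j) (Set.Iic m) := fun j ω ω' h => by
    simp only [F, stopped_congr (D := D) h m le_rfl, hH _ h]
  have hF' : ∀ j, DependsOn (fun ω : ℕ → Fin n => if ω (m + 1) = j then F j ω else 0)
      (Set.Iic (m + 1)) := fun j ω ω' h => by
    simp only [h (m + 1) Set.self_mem_Iic,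
      hF j fun t ht => h t ((Set.mem_Iic.1 ht).trans m.le_succ)]
  have hPF : ∀ j, DependsOn (fun ω : ℕ → Fin n => P (ω m) j * F j ω) (Set.Iic m) :=
    fun j ω ω' h => by simp only [h m Set.self_mem_Iic, hF j h]
  have hL : ∀ ω : ℕ → Fin n, H ω (stopped D ω (m + 1))
      = A ω + ∑ j, if ω (m + 1) = j then F j ω else 0 := by
    intro ω
    by_cases h : stopped D ω m ∈ D <;> simp [A, F, h, stopped]
  have hR : ∀ ω : ℕ → Fin n, ∑ j, stopMat P D (stopped D ω m) j * H ω j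
      = A ω + ∑ j, P (ω m) j * F j ω := by
    intro ω
    by_cases h : stopped D ω m ∈ D
    · simp [A, F, h, stopMat, ← stopped_eq_of_mem h]
    · simp [A, F, h, stopMat]
  simp only [hL, hR]
  rw [integral_add (integrable_of_dependsOn hA)
      (integrable_finsetSum _ fun j _ => integrable_of_dependsOn (hF' j)),
    integral_add (integrable_of_dependsOn hA)
      (integrable_finsetSum _ fun j _ => integrable_of_dependsOn (hPF j)),
    integral_finsetSum _ fun j _ => integrable_of_dependsOn (hF' j),
    integral_finsetSum _ fun j _ => integrable_of_dependsOn (hPF j)]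
  simp only [integral_next hPr k _ (hF _)]

theorem integral_stopped (hPr : IsMarkovFamily P Pr) (k : Fin n) (m : ℕ) (φ : Fin n → ℝ) :
    ∫ ω, φ (stopped D ω m) ∂(Pr k) = ((stopMat P D ^ m).mulVec φ) k := by
  have := hPr.1 k
  induction m generalizing φ with
  | zero =>
    rw [pow_zero, Matrix.one_mulVec]
    calc ∫ ω, φ (stopped D ω 0) ∂(Pr k) = ∫ _, φ k ∂(Pr k) := by
          refine integral_congr_ae ?_
          filter_upwards [ae_zero_eq hPr k] with ω hω
          simp [stopped, hω]
      _ = φ k := by simp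
  | succ m ih =>
    rw [integral_stopped_next hPr k (H := fun _ j => φ j) (fun j ω ω' _ => rfl),
      pow_succ, ← Matrix.mulVec_mulVec, ← ih]
    rfl

theorem isStochastic_stopMat (hP : IsStochastic P) : IsStochastic (stopMat P D) := by
  refine ⟨fun i j => ?_, fun i => ?_⟩
  · unfold stopMat
    split_ifs
    exacts [hP.1 i j, zero_le_one, le_rfl]
  · by_cases hi : i ∈ D <;> simp [stopMat, hi, hP.2]

/-- Orthogonality of martingale increments, with conditional variances of `u` bounded by the
mean squared distance to a constant. -/
theorem integral_sq_le (hP : IsStochastic P) (hPr : IsMarkovFamily P Pr) (k : Fin n)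
    {r u : Fin n → ℝ} (hu : ∀ i, u i = r i + ((stopMat P D).mulVec u) i) (m : ℕ) :
    ∫ ω, (∑ t ∈ Finset.range m, r (stopped D ω t) + u (stopped D ω m) - u k) ^ 2 ∂(Pr k)
      ≤ ∑ t ∈ Finset.range m, ∑ j, (stopMat P D ^ (t + 1)) k j * (u j - u k) ^ 2 := by
  have := hPr.1 k
  have hS := isStochastic_stopMat (D := D) hP
  induction m with
  | zero =>
    have : ∫ ω, (∑ t ∈ Finset.range 0, r (stopped D ω t) + u (stopped D ω 0) - u k) ^ 2 ∂(Pr k)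
        = ∫ _, (0 : ℝ) ∂(Pr k) := by
      refine integral_congr_ae ?_
      filter_upwards [ae_zero_eq hPr k] with ω hω
      simp [stopped, hω]
    rw [this]
    simp
  | succ m ih =>
    have hsum : ∀ (N M : ℕ), N ≤ M + 1 → DependsOn
        (fun ω : ℕ → Fin n => ∑ t ∈ Finset.range N, r (stopped D ω t)) (Set.Iic M) := by
      intro N M hNM ω ω' h
      refine Finset.sum_congr rfl fun t ht => ?_
      have := Finset.mem_range.1 ht
      rw [stopped_congr h t (by omega)]
    have hdep : DependsOn (fun ω : ℕ → Fin n => (∑ t ∈ Finset.range m, r (stopped D ω t)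
        + u (stopped D ω m) - u k) ^ 2) (Set.Iic m) := fun ω ω' h => by
      simp only [hsum m m (by omega) h, stopped_congr (D := D) h m le_rfl]
    have hpt : ∀ ω : ℕ → Fin n, ∑ j, stopMat P D (stopped D ω m) j *
          (∑ t ∈ Finset.range (m + 1), r (stopped D ω t) + u j - u k) ^ 2
        ≤ (∑ t ∈ Finset.range m, r (stopped D ω t) + u (stopped D ω m) - u k) ^ 2
          + ((stopMat P D).mulVec fun j => (u j - u k) ^ 2) (stopped D ω m) := by
      intro ω
      rw [Finset.sum_range_succ]
      generalize ∑ t ∈ Finset.range m, r (stopped D ω t) = b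
      generalize stopped D ω m = z
      have hz := hu z
      rw [mulVec_apply] at hz ⊢
      have h1 := hS.2 z
      set a := ∑ j, stopMat P D z j * u j
      have e1 : ∀ β : ℝ, ∑ j, stopMat P D z j * (u j + β) ^ 2
          = ∑ j, stopMat P D z j * u j ^ 2 + 2 * β * a + β ^ 2 := by
        intro β
        calc _ = ∑ j, (stopMat P D z j * u j ^ 2 + 2 * β * (stopMat P D z j * u j)
              + stopMat P D z j * β ^ 2) := Finset.sum_congr rfl fun j _ => by ring
          _ = _ := by
            rw [Finset.sum_add_distrib, Finset.sum_add_distrib, ← Finset.mul_sum,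
              ← Finset.sum_mul, h1, one_mul]
      have e2 := e1 (b + r z - u k)
      have e3 := e1 (-u k)
      calc _ = ∑ j, stopMat P D z j * (u j + (b + r z - u k)) ^ 2 :=
            Finset.sum_congr rfl fun j _ => by ring
        _ = (b + u z - u k) ^ 2 + ∑ j, stopMat P D z j * (u j + -u k) ^ 2 - (a - u k) ^ 2 := by
            rw [e2, e3, hz]; ring
        _ ≤ _ := by
            simp only [← sub_eq_add_neg]
            linarith [sq_nonneg (a - u k)]
    rw [integral_stopped_next hPr k (H := fun ω j =>
      (∑ t ∈ Finset.range (m + 1), r (stopped D ω t) + u j - u k) ^ 2)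
      (fun j ω ω' h => by simp only [hsum (m + 1) m le_rfl h])]
    calc _ ≤ ∫ ω, ((∑ t ∈ Finset.range m, r (stopped D ω t) + u (stopped D ω m) - u k) ^ 2
          + ((stopMat P D).mulVec fun j => (u j - u k) ^ 2) (stopped D ω m)) ∂(Pr k) := by
          refine integral_mono (integrable_of_dependsOn (m := m) fun ω ω' h => ?_)
            ((integrable_of_dependsOn hdep).add
              (integrable_of_dependsOn (dependsOn_stopped _))) hpt
          simp only [hsum (m + 1) m le_rfl h, stopped_congr (D := D) h m le_rfl]
      _ ≤ _ := by
          rw [integral_add (integrable_of_dependsOn hdep)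
            (integrable_of_dependsOn (dependsOn_stopped _)), integral_stopped hPr,
            Matrix.mulVec_mulVec, ← pow_succ, Finset.sum_range_succ, mulVec_apply]
          exact add_le_add_left ih _

end Markov

section Value

variable {P : Matrix (Fin n) (Fin n) ℝ} {Pr : Fin n → Measure (ℕ → Fin n)} {D : Finset (Fin n)}
  {R : Fin n → ℝ}

theorem IsStochastic.pow {A : Matrix (Fin n) (Fin n) ℝ} (hA : IsStochastic A) (m : ℕ) :
    IsStochastic (A ^ m) := by
  have hnn : ∀ m i j, 0 ≤ (A ^ m) i j := by
    intro m
    induction m with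
    | zero =>
      intro i j
      rw [pow_zero, Matrix.one_apply]
      split_ifs
      exacts [zero_le_one, le_rfl]
    | succ m ih =>
      intro i j
      rw [pow_succ, Matrix.mul_apply]
      exact Finset.sum_nonneg fun l _ => mul_nonneg (ih i l) (hA.1 l j)
  have hone : (A ^ m).mulVec (fun _ => 1) = fun _ => 1 := by
    induction m with
    | zero => rw [pow_zero, Matrix.one_mulVec]
    | succ m ih => rw [pow_succ, ← Matrix.mulVec_mulVec, mulVec_const hA, ih]
  refine ⟨hnn m, fun i => ?_⟩
  simpa [mulVec_apply] using congrFun hone i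

theorem exists_path_of_pow_pos (hP : IsStochastic P) (m : ℕ) (i j : Fin n)
    (h : 0 < (P ^ m) i j) :
    ∃ v : ℕ → Fin n, v 0 = i ∧ v m = j ∧ ∀ t < m, 0 < P (v t) (v (t + 1)) := by
  induction m generalizing i with
  | zero =>
    refine ⟨fun _ => i, rfl, ?_, by simp⟩
    by_contra hij
    simp [Matrix.one_apply_ne hij] at h
  | succ m ih =>
    rw [pow_succ', Matrix.mul_apply] at h
    obtain ⟨l, -, hl⟩ := Finset.exists_lt_of_sum_lt (s := Finset.univ) (f := fun _ => (0 : ℝ))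
      (by simpa using h)
    have h1 : 0 < P i l := (hP.1 i l).lt_of_ne' fun h0 => by simp [h0] at hl
    obtain ⟨v, hv0, hvm, hv⟩ := ih l (pos_of_mul_pos_right hl h1.le)
    refine ⟨fun t => Nat.casesOn t i v, rfl, hvm, fun t ht => ?_⟩
    cases t with
    | zero => simpa [hv0] using h1
    | succ t => exact hv t (by omega)

theorem escapes_stopMat (hP : IsStochastic P) (hirr : IsIrreducible P)
    (hD : D ≠ Finset.univ) : Escapes (stopMat P D) D := by
  obtain ⟨ℓ, hℓ⟩ : ∃ ℓ, ℓ ∉ D := by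
    by_contra! h
    exact hD (Finset.eq_univ_of_forall h)
  intro i _
  obtain ⟨m, -, hm⟩ := hirr i ℓ
  obtain ⟨v, h0, h1, hv⟩ := exists_path_of_pow_pos hP m i ℓ hm
  exact ⟨v, m, h0, h1 ▸ hℓ, fun t ht htD => by simpa [stopMat, htD] using hv t ht⟩

theorem le_exitT_iff {t : ℕ} {ω : ℕ → Fin n} : (t : ℕ∞) ≤ exitT D ω ↔ ∀ s < t, ω s ∈ D := by
  simp only [exitT, le_iInf_iff, Nat.cast_le]
  exact forall_congr' fun s => by rw [← not_imp_not, not_not, not_le]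

theorem stopped_mem_iff {m : ℕ} {ω : ℕ → Fin n} : stopped D ω m ∈ D ↔ ∀ s < m + 1, ω s ∈ D := by
  induction m with
  | zero => simp [stopped]
  | succ m ih =>
    rw [Nat.forall_lt_succ_right, ← ih]
    by_cases h : stopped D ω m ∈ D <;> simp [stopped, h]

theorem sum_indicator_le_exitT (ω : ℕ → Fin n) (N : ℕ) :
    ∑ t ∈ Finset.range (N + 1),
        Set.indicator {ω' : ℕ → Fin n | (t : ℕ∞) ≤ exitT D ω'} (fun ω' => R (ω' t)) ω
      = ∑ t ∈ Finset.range (N + 1), RD D R (stopped D ω t) + (R - RD D R) (stopped D ω N) := by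
  simp only [Set.indicator_apply, Set.mem_ofPred_eq, le_exitT_iff]
  induction N with
  | zero => simp [stopped]
  | succ N ih =>
    rw [Finset.sum_range_succ, ih, Finset.sum_range_succ _ (N + 1)]
    simp only [← stopped_mem_iff]
    by_cases h : stopped D ω N ∈ D <;> simp [h, stopped, RD]

theorem RD_nonneg (hR : ∀ i, 0 ≤ R i) (i : Fin n) : 0 ≤ RD D R i := by
  unfold RD
  split_ifs
  exacts [hR i, le_rfl]

/-- The expected reward collected up to time `N`. -/
def truncValue (P : Matrix (Fin n) (Fin n) ℝ) (D : Finset (Fin n)) (R : Fin n → ℝ) (N : ℕ) :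
    Fin n → ℝ :=
  ∑ t ∈ Finset.range (N + 1), (stopMat P D ^ t).mulVec (RD D R)
    + (stopMat P D ^ N).mulVec (R - RD D R)

theorem truncValue_zero : truncValue P D R 0 = R := by
  simp [truncValue]

theorem truncValue_succ (N : ℕ) :
    truncValue P D R (N + 1) = RD D R + (stopMat P D).mulVec (truncValue P D R N) := by
  rw [truncValue, truncValue, Matrix.mulVec_add, Matrix.mulVec_sum, Finset.sum_range_succ',
    pow_zero, Matrix.one_mulVec]
  simp only [Matrix.mulVec_mulVec, ← pow_succ']
  abel

theorem exists_truncValue_le (hP : IsStochastic P) (hesc : Escapes (stopMat P D) D)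
    (hR : ∀ i, 0 ≤ R i) : ∃ w : Fin n → ℝ, ∀ N i, truncValue P D R N i ≤ w i := by
  have hS := isStochastic_stopMat (D := D) hP
  obtain ⟨h0, h1⟩ := green_spec hS hesc (b := fun i => if i ∈ D then 1 else 0)
    (fun i hi => by simp [hi])
  set x := (1 - zeroD D (stopMat P D))⁻¹.mulVec fun i => if i ∈ D then 1 else 0
  have hx : ∀ i, 0 ≤ x i := nonneg_of_superharmonic hS hesc (fun i hi => (h0 i hi).ge)
    fun i hi => by rw [h1 i hi, if_pos hi]; linarith
  set M := ∑ i, R i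
  have hM : ∀ i, R i ≤ M := fun i =>
    Finset.single_le_sum (fun j _ => hR j) (Finset.mem_univ i)
  have hM0 : 0 ≤ M := Finset.sum_nonneg fun j _ => hR j
  have hSw : (stopMat P D).mulVec (M • x + fun _ => M)
      = M • (stopMat P D).mulVec x + fun _ => M := by
    rw [Matrix.mulVec_add, Matrix.mulVec_smul, mulVec_const hS]
  refine ⟨M • x + fun _ => M, fun N => ?_⟩
  induction N with
  | zero =>
    intro i
    rw [truncValue_zero]
    have := mul_nonneg hM0 (hx i)
    simp only [Pi.add_apply, Pi.smul_apply, smul_eq_mul]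
    linarith [hM i]
  | succ N ih =>
    intro i
    have h2 := mulVec_mono hS ih i
    rw [hSw] at h2
    rw [truncValue_succ]
    simp only [Pi.add_apply, Pi.smul_apply, smul_eq_mul] at h2 ⊢
    by_cases hi : i ∈ D
    · have h3 := h1 i hi
      rw [if_pos hi] at h3
      rw [h3]
      simp only [RD, hi, if_true]
      linarith [hM i]
    · have h4 : (stopMat P D).mulVec x i = x i := by simp [mulVec_apply, stopMat, hi]
      rw [h4] at h2
      simpa only [RD, hi, if_false, zero_add] using h2

theorem tendsto_truncValue (hP : IsStochastic P) (hPr : IsMarkovFamily P Pr)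
    (hesc : Escapes (stopMat P D) D) (hR : ∀ i, 0 ≤ R i) (k : Fin n) :
    Tendsto (fun N => truncValue P D R N k) atTop (nhds (valueR Pr D R k)) := by
  have := hPr.1 k
  obtain ⟨w, hw⟩ := exists_truncValue_le hP hesc hR
  set a : ℕ → (ℕ → Fin n) → ℝ := fun t ω =>
    Set.indicator {ω' : ℕ → Fin n | (t : ℕ∞) ≤ exitT D ω'} (fun ω' => R (ω' t)) ω with ha
  have ha0 : ∀ t ω, 0 ≤ a t ω := fun t ω => Set.indicator_nonneg (fun _ _ => hR _) _
  have hdep : ∀ t, DependsOn (a t) (Set.Iic t) := by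
    intro t ω ω' h
    have h1 : (∀ s < t, ω s ∈ D) ↔ ∀ s < t, ω' s ∈ D :=
      forall₂_congr fun s hs => by rw [h s (Set.mem_Iic.2 hs.le)]
    simp only [ha, Set.indicator_apply, Set.mem_ofPred_eq, le_exitT_iff, h1, h t Set.self_mem_Iic]
  have hpart : ∀ N, ∑ t ∈ Finset.range (N + 1), ∫ ω, a t ω ∂(Pr k) = truncValue P D R N k := by
    intro N
    rw [← integral_finsetSum _ fun t _ => integrable_of_dependsOn (hdep t)]
    simp only [ha, sum_indicator_le_exitT]
    rw [integral_add (integrable_finsetSum _ fun t _ =>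
        integrable_of_dependsOn (dependsOn_stopped _)) (integrable_of_dependsOn (dependsOn_stopped _)),
      integral_finsetSum _ fun t _ => integrable_of_dependsOn (dependsOn_stopped _)]
    simp only [integral_stopped hPr, truncValue, Pi.add_apply, Finset.sum_apply]
  have hint0 : ∀ t, 0 ≤ ∫ ω, a t ω ∂(Pr k) := fun t => integral_nonneg (ha0 t)
  have hsummable : Summable fun t => ∫ ω, a t ω ∂(Pr k) := by
    refine summable_of_sum_range_le (c := w k) hint0 fun N => ?_
    refine le_trans ?_ ((hpart N).trans_le (hw N k))
    rw [Finset.sum_range_succ]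
    linarith [hint0 N]
  have hval : valueR Pr D R k = ∑' t, ∫ ω, a t ω ∂(Pr k) := by
    have h1 : valueE Pr D R k = ∑' t, ENNReal.ofReal (∫ ω, a t ω ∂(Pr k)) := by
      refine tsum_congr fun t => ?_
      rw [ofReal_integral_eq_lintegral_ofReal (integrable_of_dependsOn (hdep t))
        (.of_forall (ha0 t))]
      refine lintegral_congr fun ω => ?_
      simp only [ha, Set.indicator_apply]
      split_ifs <;> simp
    rw [valueR, h1, ← ENNReal.ofReal_tsum_of_nonneg hint0 hsummable,
      ENNReal.toReal_ofReal (tsum_nonneg hint0)]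
  rw [hval]
  simpa only [Function.comp_def, hpart] using
    hsummable.hasSum.tendsto_sum_nat.comp (tendsto_add_atTop_nat 1)

/-- The value function solves the Poisson equation. -/
theorem valueR_eq (hP : IsStochastic P) (hPr : IsMarkovFamily P Pr)
    (hesc : Escapes (stopMat P D) D) (hR : ∀ i, 0 ≤ R i) (k : Fin n) :
    valueR Pr D R k = RD D R k + ((stopMat P D).mulVec (valueR Pr D R)) k := by
  have h := tendsto_truncValue hP hPr hesc hR
  refine tendsto_nhds_unique ((h k).comp (tendsto_add_atTop_nat 1)) ?_
  simp only [Function.comp_def, truncValue_succ, Pi.add_apply, mulVec_apply]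
  exact tendsto_const_nhds.add (tendsto_finsetSum _ fun j _ => (h j).const_mul _)

end Value

theorem mulVec_pow_le {A : Matrix (Fin n) (Fin n) ℝ} (hA : IsStochastic A) {u : Fin n → ℝ}
    (hu : ∀ i, (A.mulVec u) i ≤ u i) (m : ℕ) (i : Fin n) : ((A ^ m).mulVec u) i ≤ u i := by
  induction m with
  | zero => simp
  | succ m ih =>
    rw [pow_succ, ← Matrix.mulVec_mulVec]
    exact (mulVec_mono (hA.pow m) hu i).trans ih

theorem exp_neg_mul_sq_le {c β : ℝ} (hc : 0 < c) (hβ : 0 < β) (d : ℕ) :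
    Real.exp (-β * (d : ℝ) ^ 2) ≤ Real.exp (Real.log c ^ 2 / β) * (c ^ d) ^ 2 := by
  have h1 : (c ^ d) ^ 2 = Real.exp (2 * d * Real.log c) := by
    rw [← pow_mul, mul_comm d 2, ← Real.exp_log (pow_pos hc (2 * d)), Real.log_pow]
    push_cast
    rfl
  rw [h1, ← Real.exp_add, Real.exp_le_exp]
  have h2 : 0 ≤ (Real.log c + β * d) ^ 2 / β := by positivity
  have h3 : (Real.log c + β * d) ^ 2 / β
      = Real.log c ^ 2 / β + 2 * d * Real.log c + β * (d : ℝ) ^ 2 := by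
    field_simp
    ring
  linarith

/-- Sub-Gaussian transition tails compensate the oscillation bound of `u`. -/
theorem IsGreenColumn.sq_mul_le {A : Matrix (Fin n) (Fin n) ℝ} {D : Finset (Fin n)} {k : Fin n}
    {g : Fin n → ℝ} (h : IsGreenColumn A D k g) (hA : IsStochastic A)
    (hD : Escapes A D) {u : Fin n → ℝ} (hu : ∀ i, 0 ≤ u i) (hAu : ∀ i, (A.mulVec u) i ≤ u i)
    {c C β p : ℝ} (hc : 0 < c) (hβ : 0 < β) (hC : 0 < C) {ℓ : Fin n} (hkℓ : ℓ ≠ k)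
    (hconn : (pathLens A c D k ℓ).Nonempty)
    (hp : p ≤ C * Real.exp (-β * (gdist A c D k ℓ : ℝ) ^ 2)) :
    g k ^ 2 * (p * (u ℓ - u k) ^ 2) ≤ C * Real.exp (Real.log c ^ 2 / β) * u k ^ 2 := by
  have h1 := h.pow_gdist_mul_abs_le hA hD hu hAu hc hkℓ hconn
  have h2 := exp_neg_mul_sq_le hc hβ (gdist A c D k ℓ)
  have hg := h.one_le hA hD
  generalize gdist A c D k ℓ = d at *
  have h3 : (c ^ d * (g k * |u ℓ - u k|)) ^ 2 ≤ u k ^ 2 :=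
    pow_le_pow_left₀ (by positivity) h1 2
  rw [mul_pow, mul_pow, sq_abs] at h3
  calc g k ^ 2 * (p * (u ℓ - u k) ^ 2)
      = p * (g k ^ 2 * (u ℓ - u k) ^ 2) := by ring
    _ ≤ (C * (Real.exp (Real.log c ^ 2 / β) * (c ^ d) ^ 2)) * (g k ^ 2 * (u ℓ - u k) ^ 2) := by
        refine mul_le_mul_of_nonneg_right (hp.trans ?_) (by positivity)
        exact mul_le_mul_of_nonneg_left h2 hC.le
    _ = C * Real.exp (Real.log c ^ 2 / β) * ((c ^ d) ^ 2 * (g k ^ 2 * (u ℓ - u k) ^ 2)) := by ring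
    _ ≤ _ := by gcongr

/-- Theorem 2 of the paper, bound (11): under the rare-event assumptions
(minorized initial distribution, connected minorizing graph, sub-Gaussian transition tails),
`σ_i² ≤ (C/α) τ e^{(log c)²/β} n³ u(i)²`. -/
theorem stmt6 {n : ℕ} (hn : 2 ≤ n) (D : Finset (Fin n)) (hD : D.Nonempty)
    (hDne : D ≠ Finset.univ)
    (P : Matrix (Fin n) (Fin n) ℝ) (hP : IsStochastic P) (hirr : IsIrreducible P)
    (R : Fin n → ℝ) (hR : ∀ i, 0 ≤ R i)
    (τ : ℕ) (hτ : 1 ≤ τ)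
    (μ : Fin n → ℝ) (hμ0 : ∀ i, 0 ≤ μ i) (hμ1 : ∑ i, μ i = 1)
    (hμsupp : ∀ i ∉ D, μ i = 0)
    (Pr : Fin n → Measure (ℕ → Fin n)) (hPr : IsMarkovFamily P Pr)
    -- the minorizing graph (edges `i → j` with `S^τ(i,j) ≥ c`) is suitably connected
    (c : ℝ) (hc0 : 0 < c) (hc1 : c ≤ 1)
    (hconn : ∀ k ∈ D, ∀ ℓ, ℓ ≠ k → (pathLens (stopMat P D ^ τ) c D k ℓ).Nonempty)
    -- Assumption 1: `μ(k) ≥ α/n` on `D`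
    (α : ℝ) (hα : 0 < α) (hμlb : ∀ k ∈ D, α / n ≤ μ k)
    -- Assumption 3: sub-Gaussian transition probability tails
    (C β : ℝ) (hC : 0 < C) (hβ : 0 < β)
    (hdecay : ∀ i ∈ D, ∀ j, j ≠ i → ∀ t, 1 ≤ t → t ≤ τ →
      (stopMat P D ^ t) i j
        ≤ C * Real.exp (-β * (gdist (stopMat P D ^ τ) c D i j : ℝ) ^ 2))
    (i : Fin n) (hi : i ∈ D) :
    avar P Pr D R μ τ i
      ≤ C / α * τ * Real.exp ((Real.log c) ^ 2 / β) * n ^ 3 * (valueR Pr D R i) ^ 2 := by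
  obtain ⟨ℓ₀, hℓ₀⟩ : ∃ ℓ, ℓ ∉ D := by
    by_contra! h
    exact hDne (Finset.eq_univ_of_forall h)
  have hS := isStochastic_stopMat (D := D) hP
  have hA := hS.pow τ
  have hescS := escapes_stopMat hP hirr hDne
  have hescA : Escapes (stopMat P D ^ τ) D := fun k hk => by
    obtain ⟨d, v, h0, h1, -, h2⟩ := hconn k hk ℓ₀ (by rintro rfl; exact hℓ₀ hk)
    exact ⟨v, d, h0, h1 ▸ hℓ₀, fun m hm _ => hc0.trans_le (h2 m hm)⟩
  have hu_eq := valueR_eq hP hPr hescS hR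
  have hvar := integral_sq_le hP hPr (D := D) (r := RD D R) (u := valueR Pr D R) (m := τ)
    (hu := hu_eq)
  have hu0 : ∀ k, 0 ≤ valueR Pr D R k := fun k => ENNReal.toReal_nonneg
  unfold avar
  generalize valueR Pr D R = u at *
  have hAu : ∀ k, ((stopMat P D ^ τ).mulVec u) k ≤ u k := mulVec_pow_le hS
    (fun k => by linarith [hu_eq k, RD_nonneg (D := D) hR k]) τ
  set E := Real.exp (Real.log c ^ 2 / β)
  have hn0 : (0 : ℝ) < n := by exact_mod_cast (by omega : 0 < n)
  have hterm : ∀ k ∈ D, (μ k)⁻¹ * ((1 - zeroD D (stopMat P D ^ τ))⁻¹ i k) ^ 2 *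
      ∫ ω, (∑ t ∈ Finset.range τ, RD D R (stopped D ω t) + u (stopped D ω τ) - u k) ^ 2 ∂(Pr k)
      ≤ n / α * (τ * (n * (C * E)) * u i ^ 2) := by
    intro k hk
    have hg := isGreenColumn_inv hA hescA hk
    set g : Fin n → ℝ := fun j => (1 - zeroD D (stopMat P D ^ τ))⁻¹ j k
    change (μ k)⁻¹ * g i ^ 2 * _ ≤ _
    set V := ∫ ω, (∑ t ∈ Finset.range τ, RD D R (stopped D ω t) + u (stopped D ω τ) - u k) ^ 2
      ∂(Pr k)
    have hV0 : 0 ≤ V := integral_nonneg fun ω => sq_nonneg _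
    have hg1 := hg.one_le hA hescA
    have hμk : (μ k)⁻¹ ≤ n / α := by
      rw [← inv_div]
      exact inv_anti₀ (by positivity) (hμlb k hk)
    have hgV : g k ^ 2 * V ≤ τ * (n * (C * E)) * u k ^ 2 := by
      calc g k ^ 2 * V ≤ g k ^ 2 * ∑ t ∈ Finset.range τ, ∑ j,
            (stopMat P D ^ (t + 1)) k j * (u j - u k) ^ 2 := by
            gcongr
            exact hvar k
        _ = ∑ t ∈ Finset.range τ, ∑ j,
            g k ^ 2 * ((stopMat P D ^ (t + 1)) k j * (u j - u k) ^ 2) := by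
            simp only [Finset.mul_sum]
        _ ≤ ∑ t ∈ Finset.range τ, ∑ j : Fin n, C * E * u k ^ 2 := by
            refine Finset.sum_le_sum fun t ht => Finset.sum_le_sum fun j _ => ?_
            by_cases hjk : j = k
            · rw [hjk, sub_self]
              simp only [ne_eq, OfNat.ofNat_ne_zero, not_false_eq_true, zero_pow, mul_zero]
              positivity
            · exact hg.sq_mul_le hA hescA hu0 hAu hc0 hβ hC hjk (hconn k hk j hjk)
                (hdecay k hk j hjk (t + 1) (by omega) (by have := Finset.mem_range.1 ht; omega))
        _ = _ := by simp; ring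
    have hgi : g i ^ 2 * V ≤ τ * (n * (C * E)) * u i ^ 2 := by
      have h1 := pow_le_pow_left₀ (mul_nonneg (hg.nonneg hA hescA i) (hu0 k))
        (hg.mul_le_mul hA hescA hu0 hAu i) 2
      refine le_of_mul_le_mul_left ?_ (by positivity : 0 < g k ^ 2)
      calc g k ^ 2 * (g i ^ 2 * V) = g i ^ 2 * (g k ^ 2 * V) := by ring
        _ ≤ g i ^ 2 * (τ * (n * (C * E)) * u k ^ 2) := by gcongr
        _ = τ * (n * (C * E)) * (g i * u k) ^ 2 := by ring
        _ ≤ τ * (n * (C * E)) * (g k * u i) ^ 2 := by gcongr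
        _ = _ := by ring
    rw [mul_assoc]
    exact _root_.mul_le_mul hμk hgi (by positivity) (by positivity)
  calc _ ≤ ∑ k ∈ D, n / α * (τ * (n * (C * E)) * u i ^ 2) := Finset.sum_le_sum hterm
    _ = D.card * (n / α * (τ * (n * (C * E)) * u i ^ 2)) := by simp
    _ ≤ n * (n / α * (τ * (n * (C * E)) * u i ^ 2)) := by
        gcongr
        simpa using D.card_le_univ
    _ = _ := by ring

end RareTD
end
end

section
/- Assume P is irreducible. Let i, k ∈ D and ℓ, j ∈ [n] with k ≠ ℓ, and assume Q^τ(k,ℓ) > 0. Then E_i[∑_{t=0}^{T^τ−1} 1{Y_t^τ = k}] · |E_ℓ[∑_{t=0}^{T} 1{X_t = j}] − E_k[∑_{t=0}^{T} 1{X_t = j}]| ≤ E_i[∑_{t=0}^{T} 1{X_t = j}] / Q^τ(k,ℓ), where the sums over 0 ≤ t ≤ T include t = T. -/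
open MeasureTheory Finset Filter
open scoped ENNReal NNReal ENat

noncomputable section

namespace RareTD

variable {n : ℕ}

section PotentialTheory

open scoped Matrix

variable {A : Matrix (Fin n) (Fin n) ℝ} {D : Finset (Fin n)}

/-- The matrix `A` with the rows indexed outside `D` replaced by `0`: the chain is killed when it
leaves `D`. -/
def killed (D : Finset (Fin n)) (A : Matrix (Fin n) (Fin n) ℝ) : Matrix (Fin n) (Fin n) ℝ :=
  fun x y => if x ∈ D then A x y else 0

/-- Green's function of the chain killed outside `D`. -/
def greenKilled (D : Finset (Fin n)) (A : Matrix (Fin n) (Fin n) ℝ) (k x : Fin n) : ℝ :=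
  ∑' t : ℕ, (killed D A ^ t) x k

/-- Along the chain with matrix `A`, the set `D` can be left from every state. -/
def CanExit (D : Finset (Fin n)) (A : Matrix (Fin n) (Fin n) ℝ) : Prop :=
  ∀ x, ∃ m : ℕ, ∃ z ∉ D, 0 < (A ^ m) x z

lemma killed_nonneg (hA : ∀ x y, 0 ≤ A x y) (x y : Fin n) : 0 ≤ killed D A x y := by
  unfold killed
  split_ifs
  · exact hA x y
  · exact le_rfl

lemma pow_nonneg_entry (hA : ∀ x y, 0 ≤ A x y) (m : ℕ) (x y : Fin n) : 0 ≤ (A ^ m) x y := by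
  induction m generalizing x y with
  | zero => simp only [pow_zero, Matrix.one_apply]; split_ifs <;> norm_num
  | succ m ih =>
    rw [pow_succ, Matrix.mul_apply]
    exact sum_nonneg fun z _ => mul_nonneg (ih _ _) (hA _ _)

lemma mulVec_mono_s10 (hA : ∀ x y, 0 ≤ A x y) {v w : Fin n → ℝ} (h : ∀ x, v x ≤ w x) (x : Fin n) :
    (A *ᵥ v) x ≤ (A *ᵥ w) x :=
  Finset.sum_le_sum (s := univ) fun y _ => mul_le_mul_of_nonneg_left (h y) (hA x y)

lemma mulVec_nonneg (hA : ∀ x y, 0 ≤ A x y) {v : Fin n → ℝ} (h : ∀ x, 0 ≤ v x) (x : Fin n) :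
    0 ≤ (A *ᵥ v) x :=
  Finset.sum_nonneg (s := univ) fun y _ => mul_nonneg (hA x y) (h y)

lemma killed_mulVec_of_mem {x : Fin n} (hx : x ∈ D) (v : Fin n → ℝ) :
    (killed D A *ᵥ v) x = (A *ᵥ v) x := by
  simp [killed, Matrix.mulVec, dotProduct, hx]

lemma killed_mulVec_of_notMem {x : Fin n} (hx : x ∉ D) (v : Fin n → ℝ) :
    (killed D A *ᵥ v) x = 0 := by
  simp [killed, Matrix.mulVec, dotProduct, hx]

lemma exists_pos_of_pow_succ_pos (hA : ∀ x y, 0 ≤ A x y) {m : ℕ} {x z : Fin n}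
    (hx : 0 < (A ^ (m + 1)) x z) : ∃ w, 0 < A x w ∧ 0 < (A ^ m) w z := by
  rw [pow_succ', Matrix.mul_apply] at hx
  obtain ⟨w, -, hw⟩ := exists_lt_of_sum_lt (s := univ) (f := fun _ => (0 : ℝ))
    (by simpa using hx)
  have hAw : 0 < A x w := by
    rcases (hA x w).lt_or_eq with h | h
    · exact h
    · simp [← h] at hw
  refine ⟨w, hAw, ?_⟩
  by_contra h
  exact absurd hw (not_lt.2 (mul_nonpos_of_nonneg_of_nonpos hAw.le (not_lt.1 h)))

/-- If `z ∉ D` is reached from `x` in `m` steps, then the killed chain loses mass from `x` in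
`m + 1` steps. -/
lemma killed_pow_mulVec_one_lt (hA : A ∈ Matrix.rowStochastic ℝ (Fin n)) {z : Fin n} (hz : z ∉ D)
    (m : ℕ) : (∀ x, (killed D A ^ m *ᵥ 1) x ≤ 1) ∧
      ∀ x, 0 < (A ^ m) x z → (killed D A ^ (m + 1) *ᵥ 1) x < 1 := by
  have key : ∀ v : Fin n → ℝ, (∀ x, v x ≤ 1) → ∀ x, (killed D A *ᵥ v) x ≤ 1 := by
    intro v hv x
    by_cases hx : x ∈ D
    · rw [killed_mulVec_of_mem hx]
      refine (mulVec_mono_s10 hA.1 (w := 1) (by simpa using hv) x).trans ?_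
      rw [hA.2]; simp
    · rw [killed_mulVec_of_notMem hx]; norm_num
  have hle : ∀ m x, (killed D A ^ m *ᵥ 1) x ≤ 1 := by
    intro m
    induction m with
    | zero => simp
    | succ m ih =>
      rw [pow_succ', ← Matrix.mulVec_mulVec]
      exact key _ ih
  refine ⟨hle m, ?_⟩
  induction m with
  | zero =>
    intro x hx
    have : x = z := by
      by_contra h
      simp [h] at hx
    subst this
    rw [zero_add, pow_one, killed_mulVec_of_notMem hz]
    norm_num
  | succ m ih =>
    intro x hx
    rw [pow_succ', ← Matrix.mulVec_mulVec]
    by_cases hxD : x ∈ D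
    · rw [killed_mulVec_of_mem hxD]
      obtain ⟨w, hAw, hmw⟩ := exists_pos_of_pow_succ_pos hA.1 hx
      have h1 : ∑ y, A x y = 1 := Matrix.sum_row_of_mem_rowStochastic hA x
      rw [← h1]
      refine sum_lt_sum (fun y _ => ?_) ⟨w, mem_univ _, ?_⟩
      · exact mul_le_of_le_one_right (hA.1 x y) (hle _ y)
      · exact mul_lt_of_lt_one_right hAw (ih w hmw)
    · rw [killed_mulVec_of_notMem hxD]; norm_num

/-- Minimum principle for the chain killed outside `D`. -/
lemma nonneg_of_superharmonic_s10 (hA : A ∈ Matrix.rowStochastic ℝ (Fin n)) (hex : CanExit D A)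
    (h : Fin n → ℝ) (hh : ∀ x, h x < 0 → x ∈ D ∧ (A *ᵥ h) x ≤ h x) (x : Fin n) : 0 ≤ h x := by
  have hW : ∀ x y, 0 ≤ killed D A x y := killed_nonneg hA.1
  set p : Fin n → ℝ := fun x => max (-h x) 0 with hp
  have hp0 : ∀ x, 0 ≤ p x := fun x => le_max_right _ _
  have hpW : ∀ x, p x ≤ (killed D A *ᵥ p) x := by
    intro x
    by_cases hx : h x < 0
    · obtain ⟨hxD, hAx⟩ := hh x hx
      rw [killed_mulVec_of_mem hxD]
      have h1 : (A *ᵥ (-h)) x ≤ (A *ᵥ p) x :=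
        mulVec_mono_s10 hA.1 (fun y => le_max_left _ _) x
      rw [Matrix.mulVec_neg, Pi.neg_apply] at h1
      have h2 : p x = -h x := max_eq_left (by linarith)
      linarith
    · have h2 : p x = 0 := max_eq_right (by linarith)
      rw [h2]
      exact mulVec_nonneg hW hp0 x
  have hpm : ∀ (m : ℕ) x, p x ≤ (killed D A ^ m *ᵥ p) x := by
    intro m
    induction m with
    | zero => simp
    | succ m ih =>
      intro x
      rw [pow_succ', ← Matrix.mulVec_mulVec]
      exact (hpW x).trans (mulVec_mono_s10 hW ih x)
  have : Nonempty (Fin n) := ⟨x⟩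
  obtain ⟨a, ha⟩ := Finite.exists_max p
  obtain ⟨m, z, hz, hm⟩ := hex a
  have hlt := (killed_pow_mulVec_one_lt hA hz m).2 a hm
  have hle : (killed D A ^ (m + 1) *ᵥ p) a ≤ p a * (killed D A ^ (m + 1) *ᵥ 1) a := by
    have := mulVec_mono_s10 (pow_nonneg_entry hW (m + 1)) (v := p) (w := p a • 1)
      (by simpa using ha) a
    rwa [Matrix.mulVec_smul, Pi.smul_apply, smul_eq_mul] at this
  have hpa : p a ≤ 0 := by
    by_contra hpos
    have := mul_lt_of_lt_one_right (not_le.1 hpos) hlt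
    linarith [hpm (m + 1) a]
  have h1 : -h x ≤ p x := le_max_left _ _
  linarith [ha x]

lemma summable_killed_pow (hA : A ∈ Matrix.rowStochastic ℝ (Fin n)) (hex : CanExit D A)
    (k x : Fin n) : Summable fun t : ℕ => (killed D A ^ t) x k := by
  have hW : ∀ x y, 0 ≤ killed D A x y := killed_nonneg hA.1
  have hinj : Function.Injective (1 - killed D A).mulVec := by
    intro v w hvw
    have hd : ∀ v w : Fin n → ℝ, (1 - killed D A) *ᵥ v = (1 - killed D A) *ᵥ w →
        ∀ x, 0 ≤ (v - w) x := by
      intro v w hvw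
      have h1 : killed D A *ᵥ (v - w) = v - w := by
        have h0 : (1 - killed D A) *ᵥ (v - w) = 0 := by rw [Matrix.mulVec_sub, hvw, sub_self]
        rw [Matrix.sub_mulVec, Matrix.one_mulVec, sub_eq_zero] at h0
        exact h0.symm
      refine nonneg_of_superharmonic_s10 hA hex _ fun x hx => ?_
      have h2 := congrFun h1 x
      by_cases hxD : x ∈ D
      · rw [killed_mulVec_of_mem hxD] at h2
        exact ⟨hxD, h2.le⟩
      · rw [killed_mulVec_of_notMem hxD] at h2
        exact absurd h2 hx.ne'
    ext x
    have h1 := hd v w hvw x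
    have h2 := hd w v hvw.symm x
    simp only [Pi.sub_apply] at h1 h2
    linarith
  obtain ⟨φ, hφ⟩ := Matrix.mulVec_surjective_iff_isUnit.2
    (Matrix.mulVec_injective_iff_isUnit.1 hinj) (Pi.single k 1)
  have hφ' : ∀ x, φ x = (Pi.single k 1 : Fin n → ℝ) x + (killed D A *ᵥ φ) x := by
    intro x
    have := congrFun hφ x
    simp only [Matrix.sub_mulVec, Matrix.one_mulVec, Pi.sub_apply] at this
    linarith
  have hs : ∀ x, 0 ≤ (Pi.single k 1 : Fin n → ℝ) x := by
    intro x
    by_cases h : x = k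
    · subst h; simp
    · simp [h]
  have hφ0 : ∀ x, 0 ≤ φ x := by
    refine nonneg_of_superharmonic_s10 hA hex _ fun x hx => ?_
    have h2 := hφ' x
    by_cases hxD : x ∈ D
    · rw [killed_mulVec_of_mem hxD] at h2
      exact ⟨hxD, by linarith [hs x]⟩
    · rw [killed_mulVec_of_notMem hxD] at h2
      linarith [hs x]
  refine summable_of_sum_range_le (c := φ x) (fun t => pow_nonneg_entry hW t x k) fun N => ?_
  induction N generalizing x with
  | zero => simpa using hφ0 x
  | succ N ih =>
    rw [sum_range_succ', hφ' x, add_comm]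
    refine add_le_add ?_ ?_
    · simp [Matrix.one_apply, Pi.single_apply]
    · have : ∑ t ∈ range N, (killed D A ^ (t + 1)) x k =
          (killed D A *ᵥ fun y => ∑ t ∈ range N, (killed D A ^ t) y k) x := by
        simp only [pow_succ', Matrix.mul_apply, Matrix.mulVec, dotProduct, mul_sum]
        rw [sum_comm]
      rw [this]
      exact mulVec_mono_s10 hW ih x

lemma greenKilled_nonneg (hA : ∀ x y, 0 ≤ A x y) (k x : Fin n) : 0 ≤ greenKilled D A k x :=
  tsum_nonneg fun t => pow_nonneg_entry (killed_nonneg hA) t x k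

lemma greenKilled_eq (hA : A ∈ Matrix.rowStochastic ℝ (Fin n)) (hex : CanExit D A)
    (k x : Fin n) :
    greenKilled D A k x = (if x = k then 1 else 0) + (killed D A *ᵥ greenKilled D A k) x := by
  unfold greenKilled
  rw [(summable_killed_pow hA hex k x).tsum_eq_zero_add]
  simp only [pow_zero, Matrix.one_apply, pow_succ', Matrix.mul_apply, Matrix.mulVec, dotProduct]
  rw [Summable.tsum_finsetSum fun y _ => (summable_killed_pow hA hex k y).mul_left _]
  simp only [tsum_mul_left]

/-- A nonnegative function dominating `c` at `ℓ` and superharmonic on `B` dominates `c` times the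
probability of hitting `ℓ` from `B`. -/
lemma sum_killed_pow_mul_le (hA : ∀ x y, 0 ≤ A x y) {B : Finset (Fin n)} {ℓ : Fin n}
    (hℓ : ℓ ∉ B) {h : Fin n → ℝ} (h0 : ∀ x, 0 ≤ h x) (hs : ∀ x ∈ B, (A *ᵥ h) x ≤ h x)
    (N : ℕ) (x : Fin n) :
    ∑ t ∈ range N, (killed B A ^ t) x ℓ * h ℓ ≤ h x := by
  induction N generalizing x with
  | zero => simpa using h0 x
  | succ N ih =>
    have hW : ∑ t ∈ range N, (killed B A ^ (t + 1)) x ℓ * h ℓ =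
        (killed B A *ᵥ fun y => ∑ t ∈ range N, (killed B A ^ t) y ℓ * h ℓ) x := by
      simp only [pow_succ', Matrix.mul_apply, Matrix.mulVec, dotProduct, mul_sum, sum_mul]
      rw [sum_comm]
      simp only [mul_assoc]
    rw [sum_range_succ', hW]
    by_cases hx : x ∈ B
    · rw [killed_mulVec_of_mem hx]
      have hne : x ≠ ℓ := fun hxl => hℓ (hxl ▸ hx)
      simp only [pow_zero, Matrix.one_apply, hne, if_false, zero_mul, add_zero]
      exact (mulVec_mono_s10 hA ih x).trans (hs x hx)
    · rw [killed_mulVec_of_notMem hx, zero_add, pow_zero, Matrix.one_apply]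
      split_ifs with h
      · rw [h, one_mul]
      · simpa using h0 x

/-- The inequality of the key lemma, for a superharmonic function `u` and a number `Q` that is
dominated like a hitting probability of `ℓ` from `k`. -/
lemma green_mul_abs_sub_le (hA : A ∈ Matrix.rowStochastic ℝ (Fin n)) (hex : CanExit D A)
    {u : Fin n → ℝ} (hu0 : ∀ x, 0 ≤ u x) (hu : ∀ x, (A *ᵥ u) x ≤ u x) {k ℓ : Fin n}
    (hk : k ∈ D) {Q : ℝ} (hQ0 : 0 ≤ Q)
    (hQ : ∀ h : Fin n → ℝ, (∀ x, 0 ≤ h x) → (∀ x ∈ D, x ≠ k → (A *ᵥ h) x ≤ h x) →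
      Q * h ℓ ≤ (A *ᵥ h) k) (i : Fin n) :
    greenKilled D A k i * |u ℓ - u k| * Q ≤ u i := by
  set g := greenKilled D A k with hg
  have hg0 : ∀ x, 0 ≤ g x := greenKilled_nonneg hA.1 k
  have hgk : g k = 1 + (A *ᵥ g) k := by
    have := greenKilled_eq hA hex k k
    rwa [if_pos rfl, killed_mulVec_of_mem hk] at this
  have hgD : ∀ x ∈ D, x ≠ k → g x = (A *ᵥ g) x := by
    intro x hx hxk
    have := greenKilled_eq hA hex k x
    rwa [if_neg hxk, killed_mulVec_of_mem hx, zero_add] at this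
  have hgD' : ∀ x ∉ D, g x = 0 := by
    intro x hx
    have := greenKilled_eq hA hex k x
    rwa [if_neg (fun hxk : x = k => hx (hxk ▸ hk)), killed_mulVec_of_notMem hx, zero_add] at this
  have hgk1 : 1 ≤ g k := by
    have := mulVec_nonneg hA.1 hg0 k
    linarith
  have hmv : ∀ (v : Fin n → ℝ) (x : Fin n),
      (A *ᵥ (g k • v - v k • g)) x = g k * (A *ᵥ v) x - v k * (A *ᵥ g) x := by
    intro v x
    simp [Matrix.mulVec_sub, Matrix.mulVec_smul]
  have hsup : ∀ v : Fin n → ℝ, (∀ x, (A *ᵥ v) x ≤ v x) → ∀ x ∈ D, x ≠ k →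
      (A *ᵥ (g k • v - v k • g)) x ≤ (g k • v - v k • g) x := by
    intro v hv x hx hxk
    rw [hmv, ← hgD x hx hxk]
    have := mul_le_mul_of_nonneg_left (hv x) (hg0 k)
    simpa using this
  have hdom : ∀ v : Fin n → ℝ, (∀ x, 0 ≤ v x) → (∀ x, (A *ᵥ v) x ≤ v x) →
      ∀ x, 0 ≤ (g k • v - v k • g) x := by
    intro v hv0 hv
    refine nonneg_of_superharmonic_s10 hA hex _ fun x hx => ?_
    have hxk : x ≠ k := by
      rintro rfl
      simp [mul_comm] at hx
    have hxD : x ∈ D := by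
      by_contra h
      have := mul_nonneg (hg0 k) (hv0 x)
      simp only [Pi.sub_apply, Pi.smul_apply, smul_eq_mul, hgD' x h] at hx
      linarith
    exact ⟨hxD, hsup v hv x hxD hxk⟩
  have hone : ∀ x, (A *ᵥ (1 : Fin n → ℝ)) x = (1 : Fin n → ℝ) x := fun x => by rw [hA.2]
  have h1nn : ∀ x, 0 ≤ (1 : Fin n → ℝ) x := fun x => zero_le_one
  have hq1 := hQ _ (hdom 1 h1nn fun x => (hone x).le) (hsup 1 fun x => (hone x).le)
  have hqu := hQ _ (hdom u hu0 hu) (hsup u hu)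
  have hd1 := hdom 1 h1nn (fun x => (hone x).le) ℓ
  have hdℓ := hdom u hu0 hu ℓ
  have hdi := hdom u hu0 hu i
  rw [hmv] at hq1 hqu
  rw [hone] at hq1
  simp only [Pi.sub_apply, Pi.smul_apply, smul_eq_mul, Pi.one_apply, mul_one, one_mul]
    at hq1 hqu hd1 hdℓ hdi
  have huk := mul_le_mul_of_nonneg_left (hu k) (hg0 k)
  have hmain : Q * (g k * |u ℓ - u k|) ≤ u k := by
    rcases abs_cases (u ℓ - u k) with ⟨h, -⟩ | ⟨h, -⟩
    · rw [h]
      have h1 : Q * (u k * g ℓ) ≤ Q * (u k * g k) :=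
        mul_le_mul_of_nonneg_left (mul_le_mul_of_nonneg_left (by linarith) (hu0 k)) hQ0
      have h2 : (A *ᵥ g) k = g k - 1 := by linarith
      rw [h2] at hqu
      linarith
    · rw [h]
      have h1 : Q * (u k * g ℓ) ≤ Q * (g k * u ℓ) := mul_le_mul_of_nonneg_left (by linarith) hQ0
      have h2 : u k * (Q * (g k - g ℓ)) ≤ u k * 1 :=
        mul_le_mul_of_nonneg_left (by linarith) (hu0 k)
      linarith
  have h3 := mul_le_mul_of_nonneg_left hmain (hg0 i)
  have h4 : g k * (g i * |u ℓ - u k| * Q) ≤ g k * u i := by linarith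
  exact le_of_mul_le_mul_left h4 (by linarith)

lemma stopMat_nonneg {P : Matrix (Fin n) (Fin n) ℝ} (hP : ∀ x y, 0 ≤ P x y) (x y : Fin n) :
    0 ≤ stopMat P D x y := by
  unfold stopMat
  split_ifs
  · exact hP x y
  · exact zero_le_one
  · exact le_rfl

lemma stopMat_mem_rowStochastic {P : Matrix (Fin n) (Fin n) ℝ} (hP : IsStochastic P) :
    stopMat P D ∈ Matrix.rowStochastic ℝ (Fin n) := by
  rw [Matrix.mem_rowStochastic_iff_sum]
  refine ⟨stopMat_nonneg hP.1, fun x => ?_⟩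
  by_cases hx : x ∈ D
  · simpa [stopMat, hx] using hP.2 x
  · simp [stopMat, hx]

lemma stopMat_pow_of_notMem (P : Matrix (Fin n) (Fin n) ℝ) {x : Fin n} (hx : x ∉ D) (m : ℕ)
    (y : Fin n) : (stopMat P D ^ m) x y = if x = y then 1 else 0 := by
  induction m with
  | zero => simp [Matrix.one_apply]
  | succ m ih => simp [pow_succ', Matrix.mul_apply, stopMat, hx, ih]

lemma exists_notMem_pow_pos_stopMat {P : Matrix (Fin n) (Fin n) ℝ} (hP : ∀ x y, 0 ≤ P x y)
    {z : Fin n} (hz : z ∉ D) {m : ℕ} {x : Fin n} (hx : 0 < (P ^ m) x z) :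
    ∃ y ∉ D, 0 < (stopMat P D ^ m) x y := by
  by_cases hxD : x ∈ D
  · induction m generalizing x with
    | zero => exact ⟨z, hz, by simpa using hx⟩
    | succ m ih =>
      obtain ⟨w, hw, hwz⟩ := exists_pos_of_pow_succ_pos hP hx
      obtain ⟨y, hy, hwy⟩ : ∃ y ∉ D, 0 < (stopMat P D ^ m) w y := by
        by_cases hwD : w ∈ D
        · exact ih hwz hwD
        · exact ⟨w, hwD, by simp [stopMat_pow_of_notMem P hwD]⟩
      refine ⟨y, hy, ?_⟩
      rw [pow_succ', Matrix.mul_apply]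
      have hS : ∀ v, stopMat P D x v = P x v := fun v => by simp [stopMat, hxD]
      have hSn := stopMat_nonneg (D := D) hP
      refine sum_pos' (fun v _ => mul_nonneg (hSn x v) (pow_nonneg_entry hSn m v y))
        ⟨w, mem_univ _, ?_⟩
      rw [hS]
      exact mul_pos hw hwy
  · exact ⟨x, hxD, by simp [stopMat_pow_of_notMem P hxD]⟩

lemma canExit_of_isIrreducible {P : Matrix (Fin n) (Fin n) ℝ} (hirr : IsIrreducible P)
    (hD : D ≠ univ) : CanExit D P := by
  obtain ⟨z, hz⟩ : ∃ z, z ∉ D := by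
    by_contra! h
    exact hD (eq_univ_of_forall h)
  intro x
  obtain ⟨m, -, hm⟩ := hirr x z
  exact ⟨m, z, hz, hm⟩

lemma canExit_stopMat_pow {P : Matrix (Fin n) (Fin n) ℝ} (hP : IsStochastic P)
    (hex : CanExit D P) {τ : ℕ} (hτ : 1 ≤ τ) : CanExit D (stopMat P D ^ τ) := by
  intro x
  obtain ⟨m, z, hz, hm⟩ := hex x
  obtain ⟨y, hy, hxy⟩ := exists_notMem_pow_pos_stopMat hP.1 hz hm
  refine ⟨m, y, hy, ?_⟩
  obtain ⟨r, hr⟩ : ∃ r, τ * m = m + r := ⟨τ * m - m, by have := Nat.le_mul_of_pos_left m hτ; omega⟩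
  have hSn := stopMat_nonneg (D := D) hP.1
  rw [← pow_mul, hr, pow_add, Matrix.mul_apply]
  refine sum_pos' (fun v _ => mul_nonneg (pow_nonneg_entry hSn m x v) (pow_nonneg_entry hSn r v y))
    ⟨y, mem_univ _, ?_⟩
  rw [stopMat_pow_of_notMem P hy, if_pos rfl, mul_one]
  exact hxy

/-- The expected number of visits to `j` up to the exit time is superharmonic for the stopped
`τ`-step chain. -/
lemma stopMat_pow_mulVec_greenKilled_le {P : Matrix (Fin n) (Fin n) ℝ} (hP : IsStochastic P)
    (hex : CanExit D P) (j : Fin n) (τ : ℕ) (x : Fin n) :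
    (stopMat P D ^ τ *ᵥ greenKilled D P j) x ≤ greenKilled D P j x := by
  have hP' : P ∈ Matrix.rowStochastic ℝ (Fin n) := Matrix.mem_rowStochastic_iff_sum.2 hP
  have hSn := stopMat_nonneg (D := D) hP.1
  have h1 : ∀ x, (stopMat P D *ᵥ greenKilled D P j) x ≤ greenKilled D P j x := by
    intro x
    by_cases hx : x ∈ D
    · have h2 : (stopMat P D *ᵥ greenKilled D P j) x = (P *ᵥ greenKilled D P j) x := by
        simp [stopMat, Matrix.mulVec, dotProduct, hx]
      rw [greenKilled_eq hP' hex j x, killed_mulVec_of_mem hx, h2]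
      have : (0 : ℝ) ≤ if x = j then 1 else 0 := by split_ifs <;> norm_num
      linarith
    · simp [stopMat, Matrix.mulVec, dotProduct, hx]
  induction τ generalizing x with
  | zero => simp
  | succ τ ih =>
    rw [pow_succ', ← Matrix.mulVec_mulVec]
    exact (mulVec_mono_s10 hSn ih x).trans (h1 x)

end PotentialTheory

section PathLaw

open scoped Matrix

variable {A : Matrix (Fin n) (Fin n) ℝ} {Pr : Fin n → Measure (ℕ → Fin n)}

/-- The paths staying in `B s` at each time `s < r` and following `x` from time `r` to `t`. -/
def cyl (B : ℕ → Finset (Fin n)) (r t : ℕ) (x : ℕ → Fin n) : Set (ℕ → Fin n) :=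
  {ω | (∀ s < r, ω s ∈ B s) ∧ ∀ s, r ≤ s → s ≤ t → ω s = x s}

/-- The paths staying in `B s` at each time `s < t` and located at `y` at time `t`. -/
def endingAt (B : ℕ → Finset (Fin n)) (t : ℕ) (y : Fin n) : Set (ℕ → Fin n) :=
  {ω | (∀ s < t, ω s ∈ B s) ∧ ω t = y}

lemma measurableSet_cyl (B : ℕ → Finset (Fin n)) (r t : ℕ) (x : ℕ → Fin n) :
    MeasurableSet (cyl B r t x) := by
  have h : cyl B r t x = (⋂ s, ⋂ (_ : s < r), (fun ω => ω s) ⁻¹' (B s : Set (Fin n))) ∩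
      ⋂ s, ⋂ (_ : r ≤ s), ⋂ (_ : s ≤ t), (fun ω => ω s) ⁻¹' {x s} := by
    ext ω
    simp [cyl]
  rw [h]
  refine MeasurableSet.inter ?_ ?_
  · exact MeasurableSet.iInter fun s => MeasurableSet.iInter fun _ =>
      measurable_pi_apply s (Set.toFinite _).measurableSet
  · exact MeasurableSet.iInter fun s => MeasurableSet.iInter fun _ => MeasurableSet.iInter fun _ =>
      measurable_pi_apply s (Set.toFinite _).measurableSet

lemma cyl_succ (B : ℕ → Finset (Fin n)) {r t : ℕ} (hrt : r ≤ t) (x : ℕ → Fin n) :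
    cyl B (r + 1) t x = ⋃ y ∈ B r, cyl B r t (Function.update x r y) := by
  ext ω
  simp only [cyl, Set.mem_ofPred_eq, Set.mem_iUnion, exists_prop]
  constructor
  · rintro ⟨h1, h2⟩
    refine ⟨ω r, h1 r (by omega), fun s hs => h1 s (by omega), fun s hs hst => ?_⟩
    rcases eq_or_ne s r with rfl | hne
    · simp
    · rw [Function.update_of_ne hne]
      exact h2 s (by omega) hst
  · rintro ⟨y, hy, h1, h2⟩
    refine ⟨fun s hs => ?_, fun s hs hst => ?_⟩
    · rcases eq_or_ne s r with rfl | hne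
      · rw [h2 s le_rfl hrt]
        simpa using hy
      · exact h1 s (by omega)
    · rw [h2 s (by omega) hst, Function.update_of_ne (by omega)]

lemma measureReal_cyl_succ (μ : Measure (ℕ → Fin n)) [IsFiniteMeasure μ]
    (B : ℕ → Finset (Fin n)) {r t : ℕ} (hrt : r ≤ t) (x : ℕ → Fin n) :
    μ.real (cyl B (r + 1) t x) = ∑ y ∈ B r, μ.real (cyl B r t (Function.update x r y)) := by
  rw [cyl_succ B hrt, measureReal_biUnion_finset]
  · intro y _ z _ hyz
    refine Set.disjoint_left.2 fun ω hy hz => hyz ?_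
    have h1 := hy.2 r le_rfl hrt
    have h2 := hz.2 r le_rfl hrt
    simpa using h1.symm.trans h2
  · exact fun y _ => measurableSet_cyl _ _ _ _

/-- The Markov property at time `t`, on events prescribing the past. -/
lemma IsMarkovFamily.measureReal_cyl (h : IsMarkovFamily A Pr) (i : Fin n)
    (B : ℕ → Finset (Fin n)) {r t : ℕ} (hrt : r ≤ t) (x : ℕ → Fin n) :
    (Pr i).real (cyl B r (t + 1) x) = (Pr i).real (cyl B r t x) * A (x t) (x (t + 1)) := by
  have := h.1 i
  induction r generalizing x with
  | zero =>
    have h0 : ∀ t, cyl B 0 t x = {ω | ∀ s ≤ t, ω s = x s} := fun t => by simp [cyl]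
    rw [h0, h0, measureReal_def, measureReal_def, h.2, h.2, prod_range_succ, mul_assoc]
  | succ r ih =>
    rw [measureReal_cyl_succ _ B (by omega), measureReal_cyl_succ _ B (by omega), sum_mul]
    refine sum_congr rfl fun y _ => ?_
    rw [ih (by omega), Function.update_of_ne (by omega), Function.update_of_ne (by omega)]

lemma cyl_self (B : ℕ → Finset (Fin n)) (t : ℕ) (x : ℕ → Fin n) :
    cyl B t t x = endingAt B t (x t) := by
  ext ω
  refine and_congr_right fun _ => ⟨fun h => h t le_rfl le_rfl, fun h s hs hst => ?_⟩
  obtain rfl : s = t := le_antisymm hst hs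
  exact h

lemma IsMarkovFamily.endingAt_zero (h : IsMarkovFamily A Pr) (i : Fin n)
    (B : ℕ → Finset (Fin n)) (y : Fin n) :
    (Pr i).real (endingAt B 0 y) = if y = i then 1 else 0 := by
  have h0 : endingAt B 0 y = {ω | ∀ s ≤ 0, ω s = (fun _ => y) s} := by simp [endingAt]
  rw [h0, measureReal_def, h.2]
  simp

lemma IsMarkovFamily.endingAt_succ (h : IsMarkovFamily A Pr) (i : Fin n)
    (B : ℕ → Finset (Fin n)) (t : ℕ) (z : Fin n) :
    (Pr i).real (endingAt B (t + 1) z) =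
      ∑ y, (Pr i).real (endingAt B t y) * killed (B t) A y z := by
  have := h.1 i
  have h1 : endingAt B (t + 1) z = cyl B (t + 1) (t + 1) fun _ => z := by rw [cyl_self]
  rw [h1, measureReal_cyl_succ _ B (by omega)]
  simp only [h.measureReal_cyl i B le_rfl, cyl_self, Function.update_self,
    Function.update_of_ne (Nat.succ_ne_self t), killed, mul_ite, mul_zero]
  rw [sum_ite_mem, univ_inter]

/-- Law of the chain killed outside `D`. -/
lemma IsMarkovFamily.endingAt_const (h : IsMarkovFamily A Pr) (i : Fin n)
    (D : Finset (Fin n)) (t : ℕ) (y : Fin n) :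
    (Pr i).real (endingAt (fun _ => D) t y) = (killed D A ^ t) i y := by
  induction t generalizing y with
  | zero => simp [h.endingAt_zero, Matrix.one_apply, eq_comm]
  | succ t ih => simp [h.endingAt_succ, ih, pow_succ, Matrix.mul_apply]

/-- Law of the chain killed outside `D` from time `1` on. -/
lemma IsMarkovFamily.endingAt_of_pos (h : IsMarkovFamily A Pr) (i : Fin n)
    (D : Finset (Fin n)) (t : ℕ) (y : Fin n) :
    (Pr i).real (endingAt (fun s => if s = 0 then univ else D) (t + 1) y) =
      (A * killed D A ^ t) i y := by
  induction t generalizing y with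
  | zero => simp [h.endingAt_succ, h.endingAt_zero, killed]
  | succ t ih =>
    rw [h.endingAt_succ, pow_succ, ← mul_assoc, Matrix.mul_apply]
    simp [ih]

lemma coe_le_exitT_iff (D : Finset (Fin n)) (ω : ℕ → Fin n) (t : ℕ) :
    (t : ℕ∞) ≤ exitT D ω ↔ ∀ s < t, ω s ∈ D := by
  simp only [exitT, le_iInf_iff, Nat.cast_le]
  exact ⟨fun h s hs => by_contra fun hn => absurd (h s hn) (by omega),
    fun h s hs => not_lt.1 fun hst => hs (h s hst)⟩

lemma coe_lt_exitT_iff (D : Finset (Fin n)) (ω : ℕ → Fin n) (t : ℕ) :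
    (t : ℕ∞) < exitT D ω ↔ ∀ s < t + 1, ω s ∈ D := by
  rw [← coe_le_exitT_iff, Nat.cast_add, Nat.cast_one, ENat.add_one_le_iff (ENat.natCast_ne_top t)]

lemma IsMarkovFamily.toReal_greenX (h : IsMarkovFamily A Pr) (D : Finset (Fin n)) (x j : Fin n) :
    (greenX Pr D x j).toReal = greenKilled D A j x := by
  have := h.1 x
  rw [greenX, ENNReal.tsum_toReal_eq fun t => measure_ne_top _ _, greenKilled]
  refine tsum_congr fun t => ?_
  rw [← h.endingAt_const, measureReal_def]
  simp only [coe_le_exitT_iff, endingAt]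

lemma IsMarkovFamily.toReal_greenY (h : IsMarkovFamily A Pr) {D : Finset (Fin n)} {k : Fin n}
    (hk : k ∈ D) (x : Fin n) :
    (greenY Pr D x k).toReal = greenKilled D A k x := by
  rw [← h.toReal_greenX, greenY, greenX]
  congr 2 with t
  congr 1
  ext ω
  simp only [Set.mem_ofPred_eq, coe_lt_exitT_iff, coe_le_exitT_iff, Nat.lt_succ_iff_lt_or_eq]
  constructor
  · exact fun ⟨h1, h2⟩ => ⟨fun s hs => h1 s (Or.inl hs), h2⟩
  · rintro ⟨h1, h2⟩
    refine ⟨fun s hs => ?_, h2⟩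
    rcases hs with hs | rfl
    · exact h1 s hs
    · rwa [h2]

lemma Qset_subset (D : Finset (Fin n)) (k ℓ : Fin n) :
    Qset D k ℓ ⊆
      ⋃ t, endingAt (fun s => if s = 0 then univ else (D.erase k).erase ℓ) (t + 1) ℓ := by
  classical
  intro ω hω
  simp only [Qset, Set.mem_ofPred_eq, lt_min_iff] at hω
  obtain ⟨hk, hD⟩ := hω
  have hex : ∃ t, 0 < t ∧ ω t = ℓ := by
    by_contra! hn
    have : hitT {ℓ} ω = ⊤ := by
      simp only [hitT, iInf_eq_top]
      exact fun t ht => absurd ht.2 (hn t ht.1)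
    rw [this] at hk
    exact not_top_lt hk
  obtain ⟨hpos, hℓ⟩ := Nat.find_spec hex
  set m := Nat.find hex with hm
  have hmin : ∀ s, 0 < s → s < m → ω s ≠ ℓ := fun s hs hsm h => Nat.find_min hex hsm ⟨hs, h⟩
  have hhit : (m : ℕ∞) ≤ hitT {ℓ} ω := by
    simp only [hitT, le_iInf_iff, Nat.cast_le]
    exact fun t ht => Nat.find_min' hex ht
  have hout : ∀ S : Set (Fin n), hitT {ℓ} ω < hitT S ω → ∀ s, 0 < s → s < m → ω s ∉ S := by
    intro S hS s hs hsm hmem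
    have h1 : hitT S ω ≤ (s : ℕ∞) := iInf₂_le s ⟨hs, hmem⟩
    exact absurd ((hhit.trans_lt hS).trans_le h1) (not_lt.2 (Nat.cast_le.2 hsm.le))
  obtain ⟨t, ht⟩ : ∃ t, m = t + 1 := ⟨m - 1, by omega⟩
  refine Set.mem_iUnion.2 ⟨t, fun s hs => ?_, ht ▸ hℓ⟩
  rcases Nat.eq_zero_or_pos s with rfl | h0
  · simp
  · have h1 := hmin s h0 (by omega)
    have h2 := hout _ hk s h0 (by omega)
    have h3 := hout _ hD s h0 (by omega)
    simp only [Set.mem_singleton_iff, Set.mem_sdiff, Set.mem_compl_iff, mem_coe] at h2 h3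
    simp only [h0.ne', if_false, mem_erase]
    tauto

/-- Bound on the probability of hitting `ℓ` before `k` and the exit by superharmonic functions. -/
lemma IsMarkovFamily.toReal_Qset_mul_le (h : IsMarkovFamily A Pr) (hA : ∀ x y, 0 ≤ A x y)
    (D : Finset (Fin n)) (k ℓ : Fin n) {f : Fin n → ℝ} (hf0 : ∀ x, 0 ≤ f x)
    (hf : ∀ x ∈ D, x ≠ k → (A *ᵥ f) x ≤ f x) :
    (Pr k (Qset D k ℓ)).toReal * f ℓ ≤ (A *ᵥ f) k := by
  have := h.1 k
  set B := (D.erase k).erase ℓ with hB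
  have hAf := mulVec_nonneg hA hf0 k
  have hle : Pr k (Qset D k ℓ) * ENNReal.ofReal (f ℓ) ≤ ENNReal.ofReal ((A *ᵥ f) k) := by
    refine (mul_le_mul_left ((measure_mono (Qset_subset D k ℓ)).trans (measure_iUnion_le _))
      _).trans ?_
    rw [← ENNReal.tsum_mul_right]
    refine ENNReal.tsum_le_of_sum_range_le fun N => ?_
    have hterm : ∀ t, Pr k (endingAt (fun s => if s = 0 then univ else B) (t + 1) ℓ) *
        ENNReal.ofReal (f ℓ) = ENNReal.ofReal ((A * killed B A ^ t) k ℓ * f ℓ) := by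
      intro t
      rw [← h.endingAt_of_pos, ENNReal.ofReal_mul measureReal_nonneg, ofReal_measureReal]
    simp only [← hB, hterm]
    rw [← ENNReal.ofReal_sum_of_nonneg]
    · refine ENNReal.ofReal_le_ofReal ?_
      have hs : ∑ t ∈ range N, (A * killed B A ^ t) k ℓ * f ℓ =
          (A *ᵥ fun x => ∑ t ∈ range N, (killed B A ^ t) x ℓ * f ℓ) k := by
        simp only [Matrix.mul_apply, Matrix.mulVec, dotProduct, mul_sum, sum_mul]
        rw [sum_comm]
        simp only [mul_assoc]
      rw [hs]
      refine mulVec_mono_s10 hA (fun x => sum_killed_pow_mul_le hA (by simp [hB]) hf0 ?_ N x) k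
      intro x hx
      simp only [hB, mem_erase] at hx
      exact hf x hx.2.2 hx.2.1
    · intro t _
      rw [← h.endingAt_of_pos]
      exact mul_nonneg measureReal_nonneg (hf0 ℓ)
  have := ENNReal.toReal_mono ENNReal.ofReal_ne_top hle
  rwa [ENNReal.toReal_mul, ENNReal.toReal_ofReal (hf0 ℓ), ENNReal.toReal_ofReal hAf] at this

end PathLaw

/-- Lemma 2 of the paper, key lemma: for `i, k ∈ D`, `ℓ, j ∈ [n]`, `k ≠ ℓ`,
`E_i[∑_{t<T^τ} 1{Y_t^τ = k}] · |E_ℓ[∑_{t≤T} 1{X_t = j}] - E_k[∑_{t≤T} 1{X_t = j}]|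
  ≤ E_i[∑_{t≤T} 1{X_t = j}] / Q^τ(k,ℓ)`. -/
theorem stmt10 {n : ℕ} (hn : 2 ≤ n) (D : Finset (Fin n)) (hD : D.Nonempty)
    (hDne : D ≠ Finset.univ)
    (P : Matrix (Fin n) (Fin n) ℝ) (hP : IsStochastic P) (hirr : IsIrreducible P)
    (τ : ℕ) (hτ : 1 ≤ τ)
    (Pr : Fin n → Measure (ℕ → Fin n)) (hPr : IsMarkovFamily P Pr)
    -- the law of the `τ`-step chain `Y^τ`, with transition matrix `S^τ`
    (PrY : Fin n → Measure (ℕ → Fin n)) (hPrY : IsMarkovFamily (stopMat P D ^ τ) PrY)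
    (i : Fin n) (hi : i ∈ D) (k : Fin n) (hk : k ∈ D) (ℓ j : Fin n) (hkℓ : k ≠ ℓ)
    (hQ : 0 < PrY k (Qset D k ℓ)) :
    (greenY PrY D i k).toReal *
        |(greenX Pr D ℓ j).toReal - (greenX Pr D k j).toReal|
      ≤ (greenX Pr D i j).toReal / (PrY k (Qset D k ℓ)).toReal := by
  have hex := canExit_of_isIrreducible hirr hDne
  have hA := pow_mem (stopMat_mem_rowStochastic (D := D) hP) τ
  have := hPrY.1 k
  rw [le_div_iff₀ (ENNReal.toReal_pos hQ.ne' (measure_ne_top _ _)), hPrY.toReal_greenY hk,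
    hPr.toReal_greenX, hPr.toReal_greenX, hPr.toReal_greenX]
  exact green_mul_abs_sub_le hA (canExit_stopMat_pow hP hex hτ) (greenKilled_nonneg hP.1 j)
    (stopMat_pow_mulVec_greenKilled_le hP hex j τ) hk ENNReal.toReal_nonneg
    (fun f hf0 hf => hPrY.toReal_Qset_mul_le hA.1 D k ℓ hf0 hf) i

end RareTD
end
end
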